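/- Let C~, C~′, C~″ be r-perfect S-complexes over a commutative ring R. If λ~: C~ → C~′ is a (strong) height n morphism and λ~′: C~′ → C~″ is a (strong) height m morphism, with n, m ∈ Z arbitrary integers (in the generalized sense allowing negative heights), then their composition λ~′λ~, defined by the explicit composition formulas, is a (strong) height n + m morphism from C~ to C~″. -/

import Mathlib

set_option maxHeartbeats 1000000

open Function

universe u

/-- A `ℤ`-graded `R`-module, presented as an `R`-module together with a family of submodules
(the homogeneous pieces). -/
structure GradedMod (R : Type u) [CommRing R] : Type (u + 1) where
  carrier : Type u
  [isAddCommGroup : AddCommGroup carrier]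
  [isModule : Module R carrier]
  grading : ℤ → Submodule R carrier

attribute [instance] GradedMod.isAddCommGroup GradedMod.isModule

namespace GradedMod

variable {R : Type u} [CommRing R]

/-- `f` is homogeneous of degree `k` with respect to the gradings. -/
def IsDeg (M N : GradedMod R) (k : ℤ) (f : M.carrier →ₗ[R] N.carrier) : Prop :=
  ∀ i : ℤ, (M.grading i).map f ≤ N.grading (i + k)

/-- The grading is an internal direct sum decomposition with finitely generated free pieces,
only finitely many of which are nonzero; i.e., the graded module is finitely generated and
free as a graded `R`-module. -/
def IsFGFree (M : GradedMod R) : Prop :=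
  DirectSum.IsInternal M.grading ∧ (∀ i : ℤ, Module.Free R ↥(M.grading i)) ∧
    (∀ i : ℤ, Module.Finite R ↥(M.grading i)) ∧ {i : ℤ | M.grading i ≠ ⊥}.Finite

/-- `e` is the sign operator `ε`, acting on the degree `i` homogeneous part by `(-1)^i`. -/
def IsSign (M : GradedMod R) (e : M.carrier →ₗ[R] M.carrier) : Prop :=
  ∀ i : ℤ, ∀ x ∈ M.grading i, e x = if Even i then x else -x

/-- The shift `M[n]`, with `M[n]_j = M_{n+j}`. -/
def shift (M : GradedMod R) (n : ℤ) : GradedMod R where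
  carrier := M.carrier
  grading j := M.grading (n + j)

/-- Direct sum (product) of graded modules. -/
def prodGM (M N : GradedMod R) : GradedMod R where
  carrier := M.carrier × N.carrier
  grading j := (M.grading j).prod (N.grading j)

/-- Tensor product of graded modules, `(M ⊗ N)_k = ⊕_{i+j=k} M_i ⊗ N_j`. -/
noncomputable def tensorGM (M N : GradedMod R) : GradedMod R where
  carrier := TensorProduct R M.carrier N.carrier
  grading k := ⨆ i : ℤ, Submodule.map₂ (TensorProduct.mk R M.carrier N.carrier)
      (M.grading i) (N.grading (k - i))

/-- Dual of a graded module: a functional has degree `-i` if it kills all `M_j`, `j ≠ i`. -/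
def dualGM (M : GradedMod R) : GradedMod R where
  carrier := Module.Dual R M.carrier
  grading j := ⨅ (i : ℤ) (_ : i ≠ -j), (M.grading i).dualAnnihilator

end GradedMod

variable {R : Type u} [CommRing R]

/-- Iterated composition of a linear endomorphism. -/
def lpow {M : Type u} [AddCommGroup M] [Module R M] (f : M →ₗ[R] M) : ℕ → (M →ₗ[R] M)
  | 0 => LinearMap.id
  | n + 1 => f ∘ₗ lpow f n

section ProdHelpers

variable {A B C D E : Type u} [AddCommGroup A] [Module R A] [AddCommGroup B] [Module R B]
  [AddCommGroup C] [Module R C] [AddCommGroup D] [Module R D] [AddCommGroup E] [Module R E]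

def pj₁ : (A × B × C) →ₗ[R] A := LinearMap.fst R A (B × C)
def pj₂ : (A × B × C) →ₗ[R] B := (LinearMap.fst R B C) ∘ₗ (LinearMap.snd R A (B × C))
def pj₃ : (A × B × C) →ₗ[R] C := (LinearMap.snd R B C) ∘ₗ (LinearMap.snd R A (B × C))

def tri (f : D →ₗ[R] A) (g : D →ₗ[R] B) (h : D →ₗ[R] C) : D →ₗ[R] A × B × C :=
  f.prod (g.prod h)

def qj₁ : (A × B × C × D) →ₗ[R] A := LinearMap.fst R A (B × C × D)
def qj₂ : (A × B × C × D) →ₗ[R] B := (LinearMap.fst R B (C × D)) ∘ₗ (LinearMap.snd R A (B × C × D))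
def qj₃ : (A × B × C × D) →ₗ[R] C :=
  (LinearMap.fst R C D) ∘ₗ (LinearMap.snd R B (C × D)) ∘ₗ (LinearMap.snd R A (B × C × D))
def qj₄ : (A × B × C × D) →ₗ[R] D :=
  (LinearMap.snd R C D) ∘ₗ (LinearMap.snd R B (C × D)) ∘ₗ (LinearMap.snd R A (B × C × D))

def quad (f : E →ₗ[R] A) (g : E →ₗ[R] B) (h : E →ₗ[R] C) (l : E →ₗ[R] D) :
    E →ₗ[R] A × B × C × D := f.prod (g.prod (h.prod l))

end ProdHelpers

/-- The data of an `S`-complex over `R`: graded modules `C` (irreducible summand) and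
`𝖱` (reducible summand), together with the component maps of the differential
`d~ = [[d, 0, 0], [v, −d, δ₂], [δ₁, 0, r]]` with respect to `C~ = C ⊕ C[-1] ⊕ 𝖱`. -/
structure SCData (R : Type u) [CommRing R] : Type (u + 1) where
  Irr : GradedMod R
  Red : GradedMod R
  d : Irr.carrier →ₗ[R] Irr.carrier
  v : Irr.carrier →ₗ[R] Irr.carrier
  δ₁ : Irr.carrier →ₗ[R] Red.carrier
  δ₂ : Red.carrier →ₗ[R] Irr.carrier
  r : Red.carrier →ₗ[R] Red.carrier

namespace SCData

/-- The five relations equivalent to `d~ ∘ d~ = 0`. -/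
def Relations (S : SCData R) : Prop :=
  S.d ∘ₗ S.d = 0 ∧
  S.δ₁ ∘ₗ S.d + S.r ∘ₗ S.δ₁ = 0 ∧
  S.d ∘ₗ S.δ₂ - S.δ₂ ∘ₗ S.r = 0 ∧
  S.d ∘ₗ S.v - S.v ∘ₗ S.d - S.δ₂ ∘ₗ S.δ₁ = 0 ∧
  S.r ∘ₗ S.r = 0

/-- The degree conditions making `d~` a degree `−1` map on `C~ = C ⊕ C[-1] ⊕ 𝖱`. -/
def Degrees (S : SCData R) : Prop :=
  S.Irr.IsDeg S.Irr (-1) S.d ∧ S.Irr.IsDeg S.Irr (-2) S.v ∧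
  S.Irr.IsDeg S.Red (-1) S.δ₁ ∧ S.Red.IsDeg S.Irr (-2) S.δ₂ ∧
  S.Red.IsDeg S.Red (-1) S.r

/-- `S` is an `S`-complex. -/
def IsSComplex (S : SCData R) : Prop :=
  S.Irr.IsFGFree ∧ S.Red.IsFGFree ∧ S.Degrees ∧ S.Relations

/-- `S` is `r`-perfect: the reducible summand is concentrated in even degrees
(which forces `r = 0` and `δ₁ ∘ v^i ∘ δ₂ = 0` for all `i ≥ 0`). -/
def RPerfect (S : SCData R) : Prop :=
  (∀ j : ℤ, Odd j → S.Red.grading j = ⊥) ∧ S.r = 0 ∧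
    ∀ i : ℕ, S.δ₁ ∘ₗ lpow S.v i ∘ₗ S.δ₂ = 0

/-- The total graded module `C~ = C ⊕ C[-1] ⊕ 𝖱`. -/
def Tot (S : SCData R) : GradedMod R where
  carrier := S.Irr.carrier × S.Irr.carrier × S.Red.carrier
  grading j := (S.Irr.grading j).prod ((S.Irr.grading (j - 1)).prod (S.Red.grading j))

/-- The total differential `d~(c, c', ρ) = (d c, v c − d c' + δ₂ ρ, δ₁ c + r ρ)`. -/
def totalDiff (S : SCData R) : S.Tot.carrier →ₗ[R] S.Tot.carrier :=
  tri (S.d ∘ₗ pj₁) (S.v ∘ₗ pj₁ - S.d ∘ₗ pj₂ + S.δ₂ ∘ₗ pj₃) (S.δ₁ ∘ₗ pj₁ + S.r ∘ₗ pj₃)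

/-- The map `χ(c, c', ρ) = (0, c, 0)`. -/
def totalChi (S : SCData R) : S.Tot.carrier →ₗ[R] S.Tot.carrier :=
  tri 0 pj₁ 0

/-- The suspension `ΣC~`: `C_Σ = C[-2] ⊕ 𝖱[-1]`, `𝖱_Σ = 𝖱`, with the differential of
Definition 2.9 of the paper. -/
def susp (S : SCData R) : SCData R where
  Irr := { carrier := S.Irr.carrier × S.Red.carrier
           grading := fun j => (S.Irr.grading (j - 2)).prod (S.Red.grading (j - 1)) }
  Red := S.Red
  d := LinearMap.prod
      (S.d ∘ₗ LinearMap.fst R S.Irr.carrier S.Red.carrier -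
        S.δ₂ ∘ₗ LinearMap.snd R S.Irr.carrier S.Red.carrier)
      (-(S.r ∘ₗ LinearMap.snd R S.Irr.carrier S.Red.carrier))
  v := LinearMap.prod (S.v ∘ₗ LinearMap.fst R S.Irr.carrier S.Red.carrier)
      (S.δ₁ ∘ₗ LinearMap.fst R S.Irr.carrier S.Red.carrier)
  δ₁ := LinearMap.snd R S.Irr.carrier S.Red.carrier
  δ₂ := LinearMap.prod (S.v ∘ₗ S.δ₂) (S.δ₁ ∘ₗ S.δ₂)
  r := S.r

/-- The negative suspension `Σ⁻¹C~`: `C_{Σ⁻¹} = C[2] ⊕ 𝖱[2]`, `𝖱_{Σ⁻¹} = 𝖱`. -/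
def negSusp (S : SCData R) : SCData R where
  Irr := { carrier := S.Irr.carrier × S.Red.carrier
           grading := fun j => (S.Irr.grading (j + 2)).prod (S.Red.grading (j + 2)) }
  Red := S.Red
  d := LinearMap.prod (S.d ∘ₗ LinearMap.fst R S.Irr.carrier S.Red.carrier)
      (S.δ₁ ∘ₗ LinearMap.fst R S.Irr.carrier S.Red.carrier +
        S.r ∘ₗ LinearMap.snd R S.Irr.carrier S.Red.carrier)
  v := LinearMap.prod (S.v ∘ₗ LinearMap.fst R S.Irr.carrier S.Red.carrier +
        S.δ₂ ∘ₗ LinearMap.snd R S.Irr.carrier S.Red.carrier) 0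
  δ₁ := S.δ₁ ∘ₗ S.v ∘ₗ LinearMap.fst R S.Irr.carrier S.Red.carrier +
        S.δ₁ ∘ₗ S.δ₂ ∘ₗ LinearMap.snd R S.Irr.carrier S.Red.carrier
  δ₂ := LinearMap.prod 0 LinearMap.id
  r := S.r

/-- `Σ^n`, the `n`-fold (negative) suspension. -/
def suspPow (S : SCData R) : ℤ → SCData R
  | Int.ofNat n => (fun X : SCData R => X.susp)^[n] S
  | Int.negSucc n => (fun X : SCData R => X.negSusp)^[n + 1] S

/-- The shifted `S`-complex `C~[n]`: gradings shifted, same differential and `χ`-map. -/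
def shiftSC (S : SCData R) (n : ℤ) : SCData R where
  Irr := S.Irr.shift n
  Red := S.Red.shift n
  d := S.d
  v := S.v
  δ₁ := S.δ₁
  δ₂ := S.δ₂
  r := S.r

end SCData

/-- A map of `S`-complexes in block form `[[λ, 0, 0], [μ, λ, Δ₂], [Δ₁, 0, ρ]]`
(equivalently, a `χ`-equivariant map `C~ → C~'`); used both for morphisms and
(with appropriate signs in the total interpretation) for homotopies. -/
structure SMap {R : Type u} [CommRing R] (S T : SCData R) : Type u where
  lam : S.Irr.carrier →ₗ[R] T.Irr.carrier
  mu : S.Irr.carrier →ₗ[R] T.Irr.carrier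
  del1 : S.Irr.carrier →ₗ[R] T.Red.carrier
  del2 : S.Red.carrier →ₗ[R] T.Irr.carrier
  rho : S.Red.carrier →ₗ[R] T.Red.carrier

namespace SMap

variable {S T U : SCData R}

/-- The component relations equivalent to `d~' λ~ = λ~ d~`. -/
def IsMor (f : SMap S T) : Prop :=
  T.d ∘ₗ f.lam - f.lam ∘ₗ S.d = 0 ∧
  f.del1 ∘ₗ S.d + f.rho ∘ₗ S.δ₁ - T.δ₁ ∘ₗ f.lam - T.r ∘ₗ f.del1 = 0 ∧
  T.d ∘ₗ f.del2 - T.δ₂ ∘ₗ f.rho + f.lam ∘ₗ S.δ₂ + f.del2 ∘ₗ S.r = 0 ∧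
  f.mu ∘ₗ S.d + T.d ∘ₗ f.mu + f.lam ∘ₗ S.v - T.v ∘ₗ f.lam + f.del2 ∘ₗ S.δ₁ - T.δ₂ ∘ₗ f.del1 = 0 ∧
  f.rho ∘ₗ S.r - T.r ∘ₗ f.rho = 0

/-- The components have the degrees of a degree `k` map of `S`-complexes. -/
def DegreesAt (f : SMap S T) (k : ℤ) : Prop :=
  S.Irr.IsDeg T.Irr k f.lam ∧ S.Irr.IsDeg T.Irr (k - 1) f.mu ∧
  S.Irr.IsDeg T.Red k f.del1 ∧ S.Red.IsDeg T.Irr (k - 1) f.del2 ∧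
  S.Red.IsDeg T.Red k f.rho

/-- Composition of morphisms of `S`-complexes, componentwise. -/
def comp (g : SMap T U) (f : SMap S T) : SMap S U where
  lam := g.lam ∘ₗ f.lam
  mu := g.lam ∘ₗ f.mu + g.mu ∘ₗ f.lam + g.del2 ∘ₗ f.del1
  del1 := g.del1 ∘ₗ f.lam + g.rho ∘ₗ f.del1
  del2 := g.lam ∘ₗ f.del2 + g.del2 ∘ₗ f.rho
  rho := g.rho ∘ₗ f.rho

/-- `K` is an `S`-chain homotopy from `f` to `g`, i.e. `d~' K~ + K~ d~ = λ~ - λ~'` where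
`K~ = [[K, 0, 0], [L, -K, M₂], [M₁, 0, J]]`, in component form. -/
def IsHtpyFrom (K f g : SMap S T) : Prop :=
  T.d ∘ₗ K.lam + K.lam ∘ₗ S.d - f.lam + g.lam = 0 ∧
  T.δ₁ ∘ₗ K.lam + T.r ∘ₗ K.del1 + K.del1 ∘ₗ S.d + K.rho ∘ₗ S.δ₁ - f.del1 + g.del1 = 0 ∧
  -(T.d ∘ₗ K.del2) + T.δ₂ ∘ₗ K.rho - K.lam ∘ₗ S.δ₂ + K.del2 ∘ₗ S.r - f.del2 + g.del2 = 0 ∧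
  T.v ∘ₗ K.lam - T.d ∘ₗ K.mu + T.δ₂ ∘ₗ K.del1 + K.mu ∘ₗ S.d - K.lam ∘ₗ S.v + K.del2 ∘ₗ S.δ₁
    - f.mu + g.mu = 0 ∧
  T.r ∘ₗ K.rho + K.rho ∘ₗ S.r - f.rho + g.rho = 0

end SMap

/-- The identity morphism. -/
def idMap (S : SCData R) : SMap S S where
  lam := LinearMap.id
  mu := 0
  del1 := 0
  del2 := 0
  rho := LinearMap.id

/-- The total map `C~ → C~'` of a morphism in block form. -/
def morTotal {S T : SCData R} (f : SMap S T) : S.Tot.carrier →ₗ[R] T.Tot.carrier :=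
  tri (f.lam ∘ₗ pj₁) (f.mu ∘ₗ pj₁ + f.lam ∘ₗ pj₂ + f.del2 ∘ₗ pj₃) (f.del1 ∘ₗ pj₁ + f.rho ∘ₗ pj₃)

/-- The total map `C~ → C~'` of a homotopy in block form. -/
def htpTotal {S T : SCData R} (K : SMap S T) : S.Tot.carrier →ₗ[R] T.Tot.carrier :=
  tri (K.lam ∘ₗ pj₁) (K.mu ∘ₗ pj₁ - K.lam ∘ₗ pj₂ + K.del2 ∘ₗ pj₃) (K.del1 ∘ₗ pj₁ + K.rho ∘ₗ pj₃)

/-- `S`-chain homotopy equivalence of `S`-complexes. -/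
def SHomotopyEquiv (S T : SCData R) : Prop :=
  ∃ (f : SMap S T) (g : SMap T S) (H₁ : SMap S S) (H₂ : SMap T T),
    f.IsMor ∧ f.DegreesAt 0 ∧ g.IsMor ∧ g.DegreesAt 0 ∧
    H₁.DegreesAt 1 ∧ SMap.IsHtpyFrom H₁ (g.comp f) (idMap S) ∧
    H₂.DegreesAt 1 ∧ SMap.IsHtpyFrom H₂ (f.comp g) (idMap T)

/-- Isomorphism of `S`-complexes: a (degree `0`) morphism with a two-sided inverse morphism. -/
def SIso (S T : SCData R) : Prop :=
  ∃ (f : SMap S T) (g : SMap T S), f.IsMor ∧ f.DegreesAt 0 ∧ g.IsMor ∧ g.DegreesAt 0 ∧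
    g.comp f = idMap S ∧ f.comp g = idMap T

/-- The suspension `Σλ~` of a morphism `λ~`, in block form. -/
def suspMap {S T : SCData R} (f : SMap S T) : SMap S.susp T.susp where
  lam := LinearMap.prod
      (f.lam ∘ₗ LinearMap.fst R S.Irr.carrier S.Red.carrier +
        f.del2 ∘ₗ LinearMap.snd R S.Irr.carrier S.Red.carrier)
      (f.rho ∘ₗ LinearMap.snd R S.Irr.carrier S.Red.carrier)
  mu := LinearMap.prod (f.mu ∘ₗ LinearMap.fst R S.Irr.carrier S.Red.carrier)
      (f.del1 ∘ₗ LinearMap.fst R S.Irr.carrier S.Red.carrier)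
  del1 := 0
  del2 := LinearMap.prod (f.mu ∘ₗ S.δ₂ + T.v ∘ₗ f.del2) (f.del1 ∘ₗ S.δ₂ + T.δ₁ ∘ₗ f.del2)
  rho := f.rho

/-- The suspension `ΣK~` of a homotopy `K~`, in block form. -/
def suspHtpy {S T : SCData R} (K : SMap S T) : SMap S.susp T.susp where
  lam := LinearMap.prod
      (K.lam ∘ₗ LinearMap.fst R S.Irr.carrier S.Red.carrier -
        K.del2 ∘ₗ LinearMap.snd R S.Irr.carrier S.Red.carrier)
      (-(K.rho ∘ₗ LinearMap.snd R S.Irr.carrier S.Red.carrier))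
  mu := LinearMap.prod (K.mu ∘ₗ LinearMap.fst R S.Irr.carrier S.Red.carrier)
      (K.del1 ∘ₗ LinearMap.fst R S.Irr.carrier S.Red.carrier)
  del1 := 0
  del2 := LinearMap.prod (T.v ∘ₗ K.del2 + K.mu ∘ₗ S.δ₂) (T.δ₁ ∘ₗ K.del2 + K.del1 ∘ₗ S.δ₂)
  rho := K.rho

/-- The sequence `τ_0 = ρ`, `τ_{i+1} = δ₁'v'^iΔ₂ + Δ₁v^iδ₂ + Σ_{j<i} δ₁'v'^j μ v^{i−1−j} δ₂`
attached to an (even degree) morphism between `r`-perfect `S`-complexes. -/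
def tauSMap {S T : SCData R} (f : SMap S T) : ℕ → (S.Red.carrier →ₗ[R] T.Red.carrier)
  | 0 => f.rho
  | i + 1 =>
      T.δ₁ ∘ₗ lpow T.v i ∘ₗ f.del2 + f.del1 ∘ₗ lpow S.v i ∘ₗ S.δ₂ +
        ∑ j ∈ Finset.range i, T.δ₁ ∘ₗ lpow T.v j ∘ₗ f.mu ∘ₗ lpow S.v (i - 1 - j) ∘ₗ S.δ₂

/-- Height `n` (for `n ≥ 0`): `τ_j = 0` for `0 ≤ j < n`. -/
def SMap.HasHeight {S T : SCData R} (f : SMap S T) (n : ℕ) : Prop :=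
  ∀ j : ℕ, j < n → tauSMap f j = 0

/-- Strong height `n`: height `n` and `τ_n` an isomorphism. -/
def SMap.StrongHeight {S T : SCData R} (f : SMap S T) (n : ℕ) : Prop :=
  f.HasHeight n ∧ Function.Bijective ⇑(tauSMap f n)

/-- The explicit model of the `n`-fold suspension `Σ^n C~` of an `r`-perfect `S`-complex:
`C_{Σ^n} = C[-2n] ⊕ ⊕_{i=0}^{n-1} 𝖱[-2i-1]` (the `m`-th factor of `Fin n → 𝖱` being
`𝖱[-2(n-1-m)-1]`), `𝖱_{Σ^n} = 𝖱`, with the components of the differential as in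
Subsection 2.4 of the paper. -/
def SCData.suspN (S : SCData R) (n : ℕ) : SCData R where
  Irr := { carrier := S.Irr.carrier × (Fin n → S.Red.carrier)
           grading := fun j => (S.Irr.grading (j - 2 * (n : ℤ))).prod
             (Submodule.pi Set.univ fun m : Fin n =>
               S.Red.grading (j - 2 * (((n - 1 - (m : ℕ) : ℕ)) : ℤ) - 1)) }
  Red := S.Red
  d := LinearMap.prod
      (S.d ∘ₗ LinearMap.fst R S.Irr.carrier (Fin n → S.Red.carrier) -
        ∑ m : Fin n, lpow S.v (m : ℕ) ∘ₗ S.δ₂ ∘ₗ LinearMap.proj m ∘ₗ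
          LinearMap.snd R S.Irr.carrier (Fin n → S.Red.carrier)) 0
  v := LinearMap.prod (S.v ∘ₗ LinearMap.fst R S.Irr.carrier (Fin n → S.Red.carrier))
      (LinearMap.pi fun m : Fin n =>
        if (m : ℕ) = 0 then S.δ₁ ∘ₗ LinearMap.fst R S.Irr.carrier (Fin n → S.Red.carrier)
        else LinearMap.proj (⟨(m : ℕ) - 1, lt_of_le_of_lt (Nat.sub_le _ _) m.isLt⟩ : Fin n) ∘ₗ
          LinearMap.snd R S.Irr.carrier (Fin n → S.Red.carrier))
  δ₁ := if h : 0 < n then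
      LinearMap.proj (⟨n - 1, Nat.sub_lt h Nat.one_pos⟩ : Fin n) ∘ₗ
        LinearMap.snd R S.Irr.carrier (Fin n → S.Red.carrier)
    else 0
  δ₂ := LinearMap.prod (lpow S.v n ∘ₗ S.δ₂) 0
  r := 0

/-- The natural morphism `ι~_n : C~ → Σ^n C~`, with `λ`-component `c ↦ (c, 0, …, 0)` and
`Δ₂`-component `θ ↦ (0, θ, 0, …, 0)`. -/
def iotaN (S : SCData R) (n : ℕ) : SMap S (S.suspN n) where
  lam := LinearMap.prod LinearMap.id 0
  mu := 0
  del1 := 0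
  del2 := LinearMap.prod 0 (LinearMap.pi fun m : Fin n => if (m : ℕ) = 0 then LinearMap.id else 0)
  rho := 0

/-- The data of a generalized height morphism between `r`-perfect `S`-complexes:
the four maps `λ, μ, Δ₁, Δ₂` and the sequence `τ_i` for `i ∈ ℤ`. -/
structure HMor {R : Type u} [CommRing R] (S T : SCData R) : Type u where
  lam : S.Irr.carrier →ₗ[R] T.Irr.carrier
  mu : S.Irr.carrier →ₗ[R] T.Irr.carrier
  del1 : S.Irr.carrier →ₗ[R] T.Red.carrier
  del2 : S.Red.carrier →ₗ[R] T.Irr.carrier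
  tau : ℤ → (S.Red.carrier →ₗ[R] T.Red.carrier)

/-- `f` is a height `n` morphism of (even) degree `k` between `r`-perfect `S`-complexes. -/
def HMor.IsHeightMor {S T : SCData R} (f : HMor S T) (n : ℤ) (k : ℤ) : Prop :=
  Even k ∧
  S.Irr.IsDeg T.Irr k f.lam ∧ S.Irr.IsDeg T.Irr (k - 1) f.mu ∧
  S.Irr.IsDeg T.Red k f.del1 ∧ S.Red.IsDeg T.Irr (k - 1) f.del2 ∧
  (∀ i : ℤ, S.Red.IsDeg T.Red (k - 2 * i) (f.tau i)) ∧
  (∀ i : ℤ, i < n → f.tau i = 0) ∧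
  (∀ i : ℕ, f.tau ((i : ℤ) + 1) =
      T.δ₁ ∘ₗ lpow T.v i ∘ₗ f.del2 + f.del1 ∘ₗ lpow S.v i ∘ₗ S.δ₂ +
        ∑ j ∈ Finset.range i, T.δ₁ ∘ₗ lpow T.v j ∘ₗ f.mu ∘ₗ lpow S.v (i - 1 - j) ∘ₗ S.δ₂) ∧
  (T.d ∘ₗ f.lam - f.lam ∘ₗ S.d -
      ∑ᶠ i : ℕ, ∑ j ∈ Finset.range (i + 1),
        lpow T.v j ∘ₗ T.δ₂ ∘ₗ f.tau (-((i : ℤ) + 1)) ∘ₗ S.δ₁ ∘ₗ lpow S.v (i - j) = 0) ∧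
  (-(T.δ₁ ∘ₗ f.lam) + f.del1 ∘ₗ S.d + ∑ᶠ i : ℕ, f.tau (-(i : ℤ)) ∘ₗ S.δ₁ ∘ₗ lpow S.v i = 0) ∧
  (f.lam ∘ₗ S.δ₂ + T.d ∘ₗ f.del2 - ∑ᶠ i : ℕ, lpow T.v i ∘ₗ T.δ₂ ∘ₗ f.tau (-(i : ℤ)) = 0) ∧
  (f.mu ∘ₗ S.d + T.d ∘ₗ f.mu + f.lam ∘ₗ S.v - T.v ∘ₗ f.lam + f.del2 ∘ₗ S.δ₁ - T.δ₂ ∘ₗ f.del1 = 0)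

/-- Composition of generalized height morphisms (Definition 2.23 of the paper). -/
noncomputable def HMor.compH {S T U : SCData R} (g : HMor T U) (f : HMor S T) : HMor S U where
  lam := g.lam ∘ₗ f.lam
    + (∑ᶠ i : ℕ, ∑ j ∈ Finset.range (i + 1),
        lpow U.v j ∘ₗ U.δ₂ ∘ₗ g.tau (-((i : ℤ) + 1)) ∘ₗ f.del1 ∘ₗ lpow S.v (i - j))
    + (∑ᶠ i : ℕ, ∑ j ∈ Finset.range (i + 1),
        lpow U.v j ∘ₗ g.del2 ∘ₗ f.tau (-((i : ℤ) + 1)) ∘ₗ S.δ₁ ∘ₗ lpow S.v (i - j))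
    + (∑ᶠ i : ℕ, ∑ j ∈ Finset.range (i + 1), ∑ l ∈ Finset.range (i - j + 1),
        lpow U.v j ∘ₗ U.δ₂ ∘ₗ g.tau (-((i : ℤ) + 2)) ∘ₗ T.δ₁ ∘ₗ lpow T.v l ∘ₗ f.mu ∘ₗ
          lpow S.v (i - j - l))
    + (∑ᶠ i : ℕ, ∑ j ∈ Finset.range (i + 1), ∑ l ∈ Finset.range (i - j + 1),
        lpow U.v j ∘ₗ g.mu ∘ₗ lpow T.v l ∘ₗ T.δ₂ ∘ₗ f.tau (-((i : ℤ) + 2)) ∘ₗ S.δ₁ ∘ₗ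
          lpow S.v (i - j - l))
  mu := g.lam ∘ₗ f.mu + g.mu ∘ₗ f.lam + g.del2 ∘ₗ f.del1
  del1 := g.del1 ∘ₗ f.lam + (∑ᶠ i : ℕ, g.tau (-(i : ℤ)) ∘ₗ f.del1 ∘ₗ lpow S.v i)
    + (∑ᶠ i : ℕ, ∑ j ∈ Finset.range (i + 1),
        g.tau (-((i : ℤ) + 1)) ∘ₗ T.δ₁ ∘ₗ lpow T.v j ∘ₗ f.mu ∘ₗ lpow S.v (i - j))
  del2 := g.lam ∘ₗ f.del2 + (∑ᶠ i : ℕ, lpow U.v i ∘ₗ g.del2 ∘ₗ f.tau (-(i : ℤ)))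
    + (∑ᶠ i : ℕ, ∑ j ∈ Finset.range (i + 1),
        lpow U.v j ∘ₗ g.mu ∘ₗ lpow T.v (i - j) ∘ₗ T.δ₂ ∘ₗ f.tau (-((i : ℤ) + 1)))
  tau := fun i => ∑ᶠ l : ℤ, g.tau (i - l) ∘ₗ f.tau l

/-- The strong height `−n` morphism `κ~_n : Σ^n C~ → C~`. -/
def kappaN (T : SCData R) (n : ℕ) : HMor (T.suspN n) T where
  lam := LinearMap.fst R T.Irr.carrier (Fin n → T.Red.carrier)
  mu := 0
  del1 := 0
  del2 := 0
  tau := fun i => if i = -(n : ℤ) then LinearMap.id else 0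

/-- An (even degree) morphism of `S`-complexes, regarded as a generalized height morphism. -/
def SMap.toHMor {S T : SCData R} (f : SMap S T) : HMor S T where
  lam := f.lam
  mu := f.mu
  del1 := f.del1
  del2 := f.del2
  tau := fun i => if 0 ≤ i then tauSMap f i.toNat else 0

/-- The height `0` morphism `λ~' : C~ → Σ^n C~'` associated to a height `−n` morphism
(Proposition 2.25 of the paper). -/
def heightNegToSusp {S T : SCData R} (f : HMor S T) (n : ℕ) : SMap S (T.suspN n) where
  lam := LinearMap.prod f.lam
    (LinearMap.pi fun m : Fin n =>
      ∑ i ∈ Finset.Icc ((m : ℕ) + 1) n, f.tau (-(i : ℤ)) ∘ₗ S.δ₁ ∘ₗ lpow S.v (i - 1 - (m : ℕ)))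
  mu := LinearMap.prod f.mu (LinearMap.pi fun m : Fin n => if (m : ℕ) = 0 then f.del1 else 0)
  del1 := 0
  del2 := LinearMap.prod f.del2 (LinearMap.pi fun m : Fin n => f.tau (-((m : ℕ) : ℤ)))
  rho := f.tau (-(n : ℤ))

/-- The morphism `ι~₁ : C~ → ΣC~`. -/
def iotaOne (S : SCData R) : SMap S S.susp where
  lam := LinearMap.prod LinearMap.id 0
  mu := 0
  del1 := 0
  del2 := LinearMap.prod 0 LinearMap.id
  rho := 0

/-- The morphism `λ~'' : ΣC~' → C~''` associated to an odd degree morphism `λ~'` together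
with the map `ν' : 𝖱' → 𝖱''` (Subsection 2.6 of the paper). -/
def lambdaSecond {S T : SCData R} (f : SMap S T) (nu : S.Red.carrier →ₗ[R] T.Red.carrier) :
    SMap S.susp T where
  lam := f.lam ∘ₗ LinearMap.fst R S.Irr.carrier S.Red.carrier +
    f.del2 ∘ₗ LinearMap.snd R S.Irr.carrier S.Red.carrier
  mu := f.mu ∘ₗ LinearMap.fst R S.Irr.carrier S.Red.carrier
  del1 := f.del1 ∘ₗ LinearMap.fst R S.Irr.carrier S.Red.carrier +
    nu ∘ₗ LinearMap.snd R S.Irr.carrier S.Red.carrier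
  del2 := f.mu ∘ₗ S.δ₂ + T.v ∘ₗ f.del2 + T.δ₂ ∘ₗ nu
  rho := 0

/-- The morphism `λ~₁ : C~ → ΣC~'` associated to height `−1` morphism data
`(λ, μ, Δ₁, Δ₂, τ₀, τ₋₁)`, in block form
`[[λ, 0, 0], [τ₋₁δ₁, 0, 0], [μ, λ, Δ₂], [Δ₁, τ₋₁δ₁, τ₀], [0, 0, τ₋₁]]`. -/
def hNegOneSusp {S T : SCData R} (lam0 mu0 : S.Irr.carrier →ₗ[R] T.Irr.carrier)
    (del10 : S.Irr.carrier →ₗ[R] T.Red.carrier) (del20 : S.Red.carrier →ₗ[R] T.Irr.carrier)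
    (tau0 taum1 : S.Red.carrier →ₗ[R] T.Red.carrier) : SMap S T.susp where
  lam := LinearMap.prod lam0 (taum1 ∘ₗ S.δ₁)
  mu := LinearMap.prod mu0 del10
  del1 := 0
  del2 := LinearMap.prod del20 tau0
  rho := taum1

/-- The mapping cone of a degree `k` morphism `λ~ : C~ → C~'`, as an `S`-complex;
its underlying graded module is `C~[-1-k] ⊕ C~'`. -/
def coneSC {S T : SCData R} (f : SMap S T) (k : ℤ) : SCData R where
  Irr := { carrier := S.Irr.carrier × T.Irr.carrier
           grading := fun j => (S.Irr.grading (j - 1 - k)).prod (T.Irr.grading j) }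
  Red := { carrier := S.Red.carrier × T.Red.carrier
           grading := fun j => (S.Red.grading (j - 1 - k)).prod (T.Red.grading j) }
  d := LinearMap.prod (-(S.d ∘ₗ LinearMap.fst R S.Irr.carrier T.Irr.carrier))
      (f.lam ∘ₗ LinearMap.fst R S.Irr.carrier T.Irr.carrier +
        T.d ∘ₗ LinearMap.snd R S.Irr.carrier T.Irr.carrier)
  v := LinearMap.prod (S.v ∘ₗ LinearMap.fst R S.Irr.carrier T.Irr.carrier)
      (f.mu ∘ₗ LinearMap.fst R S.Irr.carrier T.Irr.carrier +
        T.v ∘ₗ LinearMap.snd R S.Irr.carrier T.Irr.carrier)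
  δ₁ := LinearMap.prod (-(S.δ₁ ∘ₗ LinearMap.fst R S.Irr.carrier T.Irr.carrier))
      (f.del1 ∘ₗ LinearMap.fst R S.Irr.carrier T.Irr.carrier +
        T.δ₁ ∘ₗ LinearMap.snd R S.Irr.carrier T.Irr.carrier)
  δ₂ := LinearMap.prod (S.δ₂ ∘ₗ LinearMap.fst R S.Red.carrier T.Red.carrier)
      (f.del2 ∘ₗ LinearMap.fst R S.Red.carrier T.Red.carrier +
        T.δ₂ ∘ₗ LinearMap.snd R S.Red.carrier T.Red.carrier)
  r := LinearMap.prod (-(S.r ∘ₗ LinearMap.fst R S.Red.carrier T.Red.carrier))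
      (f.rho ∘ₗ LinearMap.fst R S.Red.carrier T.Red.carrier +
        T.r ∘ₗ LinearMap.snd R S.Red.carrier T.Red.carrier)

/-- Direct sum of `S`-complexes. -/
def sumSC (S T : SCData R) : SCData R where
  Irr := S.Irr.prodGM T.Irr
  Red := S.Red.prodGM T.Red
  d := S.d.prodMap T.d
  v := S.v.prodMap T.v
  δ₁ := S.δ₁.prodMap T.δ₁
  δ₂ := S.δ₂.prodMap T.δ₂
  r := S.r.prodMap T.r

/-- The dual `S`-complex `C~†`, defined using sign operators on the dual graded modules:
`m†(f) = −ε(f) f ∘ m`, with the roles of `δ₁` and `δ₂` interchanged. -/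
def dualSC (S : SCData R)
    (eCd : Module.Dual R S.Irr.carrier →ₗ[R] Module.Dual R S.Irr.carrier)
    (eRd : Module.Dual R S.Red.carrier →ₗ[R] Module.Dual R S.Red.carrier) : SCData R where
  Irr := S.Irr.dualGM
  Red := S.Red.dualGM
  d := -(S.d.dualMap ∘ₗ eCd)
  v := -(S.v.dualMap ∘ₗ eCd)
  δ₁ := -(S.δ₂.dualMap ∘ₗ eCd)
  δ₂ := -(S.δ₁.dualMap ∘ₗ eRd)
  r := -(S.r.dualMap ∘ₗ eRd)

/-- The rank-one graded module `R`, concentrated in degree `n`. -/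
def unitGM (R : Type u) [CommRing R] (n : ℤ) : GradedMod R where
  carrier := R
  grading j := if j = n then ⊤ else ⊥

/-- The `S`-complex `O~(1)`: `C = R` in degree `1`, `𝖱 = R` in degree `0`, `δ₁ = id`. -/
def O1 (R : Type u) [CommRing R] : SCData R where
  Irr := unitGM R 1
  Red := unitGM R 0
  d := 0
  v := 0
  δ₁ := LinearMap.id
  δ₂ := 0
  r := 0

/-- The `S`-complex `O~(-1)`: `C = R` in degree `-2`, `𝖱 = R` in degree `0`, `δ₂ = id`. -/
def Om1 (R : Type u) [CommRing R] : SCData R where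
  Irr := unitGM R (-2)
  Red := unitGM R 0
  d := 0
  v := 0
  δ₁ := 0
  δ₂ := LinearMap.id
  r := 0

/-- The `S`-complex `O~(0)`: `C = 0`, `𝖱 = R` in degree `0`, zero differential. -/
def O0 (R : Type u) [CommRing R] : SCData R where
  Irr := { carrier := ↥(⊥ : Submodule R R), grading := fun _ => ⊥ }
  Red := unitGM R 0
  d := 0
  v := 0
  δ₁ := 0
  δ₂ := 0
  r := 0

/-- The `S`-complex representation of the tensor product `C~ ⊗ C~'` of `S`-complexes
(Subsection 2.2 of the paper), where `eC`, `eR` are the sign operators of the first factor: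
`C^⊗ = (C⊗C') ⊕ (C⊗C')[-1] ⊕ (C⊗𝖱') ⊕ (𝖱⊗C')` and `𝖱^⊗ = 𝖱⊗𝖱'`. -/
noncomputable def tensorRep (S T : SCData R)
    (eC : S.Irr.carrier →ₗ[R] S.Irr.carrier) (eR : S.Red.carrier →ₗ[R] S.Red.carrier) :
    SCData R where
  Irr := (S.Irr.tensorGM T.Irr).prodGM (((S.Irr.tensorGM T.Irr).shift (-1)).prodGM
      ((S.Irr.tensorGM T.Red).prodGM (S.Red.tensorGM T.Irr)))
  Red := S.Red.tensorGM T.Red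
  d := quad
      (TensorProduct.map S.d LinearMap.id ∘ₗ qj₁ + TensorProduct.map eC T.d ∘ₗ qj₁)
      (TensorProduct.map (-(eC ∘ₗ S.v)) LinearMap.id ∘ₗ qj₁ + TensorProduct.map eC T.v ∘ₗ qj₁
        + TensorProduct.map S.d LinearMap.id ∘ₗ qj₂ - TensorProduct.map eC T.d ∘ₗ qj₂
        + TensorProduct.map eC T.δ₂ ∘ₗ qj₃
        + TensorProduct.map (-(eC ∘ₗ S.δ₂)) LinearMap.id ∘ₗ qj₄)
      (TensorProduct.map eC T.δ₁ ∘ₗ qj₁ + TensorProduct.map S.d LinearMap.id ∘ₗ qj₃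
        + TensorProduct.map eC T.r ∘ₗ qj₃)
      (TensorProduct.map S.δ₁ LinearMap.id ∘ₗ qj₁ + TensorProduct.map eR T.d ∘ₗ qj₄
        + TensorProduct.map S.r LinearMap.id ∘ₗ qj₄)
  v := quad
      (TensorProduct.map S.v LinearMap.id ∘ₗ qj₁ + TensorProduct.map S.δ₂ LinearMap.id ∘ₗ qj₄)
      (TensorProduct.map S.v LinearMap.id ∘ₗ qj₂)
      (TensorProduct.map S.v LinearMap.id ∘ₗ qj₃)
      (TensorProduct.map (eR ∘ₗ S.δ₁) LinearMap.id ∘ₗ qj₂ + TensorProduct.map LinearMap.id T.v ∘ₗ qj₄)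
  δ₁ := TensorProduct.map S.δ₁ LinearMap.id ∘ₗ qj₃ + TensorProduct.map eR T.δ₁ ∘ₗ qj₄
  δ₂ := quad 0 0 (TensorProduct.map S.δ₂ LinearMap.id) (TensorProduct.map LinearMap.id T.δ₂)
  r := TensorProduct.map S.r LinearMap.id + TensorProduct.map eR T.r

/-- Homology of an endomorphism (thought of as a differential): `ker D / im D`. -/
abbrev homologyOf {M : Type u} [AddCommGroup M] [Module R M] (D : M →ₗ[R] M) : Type u :=
  ↥(LinearMap.ker D) ⧸
    Submodule.comap (LinearMap.ker D).subtype (LinearMap.range D)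

/-- The map induced on homology by a chain map. -/
def inducedMap {M N : Type u} [AddCommGroup M] [Module R M] [AddCommGroup N] [Module R N]
    (DM : M →ₗ[R] M) (DN : N →ₗ[R] N) (f : M →ₗ[R] N) (h : DN ∘ₗ f = f ∘ₗ DM) :
    homologyOf DM →ₗ[R] homologyOf DN :=
  Submodule.mapQ _ _
    (f.restrict (p := LinearMap.ker DM) (q := LinearMap.ker DN) (fun x hx => by
      have h1 : DN (f x) = f (DM x) := by
        have h2 := LinearMap.congr_fun h x
        simpa using h2
      have hx0 : DM x = 0 := LinearMap.mem_ker.mp hx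
      simp [LinearMap.mem_ker, h1, hx0]))
    (by
      intro x hx
      simp only [Submodule.mem_comap] at hx ⊢
      obtain ⟨y, hy⟩ := hx
      refine ⟨f y, ?_⟩
      have h1 : DN (f y) = f (DM y) := by
        have h2 := LinearMap.congr_fun h y
        simpa using h2
      simp only [Submodule.coe_subtype] at hy ⊢
      rw [LinearMap.restrict_apply]
      rw [h1, hy])

/-- The degree `j` homology of a graded module with a (degree `-1`) differential. -/
abbrev gradedHomology (M : GradedMod R) (D : M.carrier →ₗ[R] M.carrier) (j : ℤ) : Type u :=
  ↥(M.grading j ⊓ LinearMap.ker D) ⧸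
    Submodule.comap (M.grading j ⊓ LinearMap.ker D).subtype ((M.grading (j + 1)).map D)

/-- The Euler characteristic `Σ_j (-1)^j rk_R M_j` of a graded module. -/
noncomputable def eulerChar (M : GradedMod R) : ℤ :=
  ∑ᶠ j : ℤ, (if Even j then (1 : ℤ) else -1) * (Module.finrank R ↥(M.grading j) : ℤ)

/-- The small equivariant complex `Ĉ = C[-1] ⊕ 𝖱[x]`, with `𝖱[x]` modelled as `ℕ →₀ 𝖱`. -/
abbrev hatC (S : SCData R) : Type u := S.Irr.carrier × (ℕ →₀ S.Red.carrier)

/-- The differential `𝔡̂(α, θxⁱ) = (dα − vⁱδ₂θ, 0)`. -/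
noncomputable def hatD (S : SCData R) : hatC S →ₗ[R] hatC S :=
  LinearMap.prod
    (S.d ∘ₗ LinearMap.fst R S.Irr.carrier (ℕ →₀ S.Red.carrier) -
      (Finsupp.lsum ℕ fun i : ℕ => lpow S.v i ∘ₗ S.δ₂) ∘ₗ
        LinearMap.snd R S.Irr.carrier (ℕ →₀ S.Red.carrier))
    0

/-- The `x`-action `x·(α, θxⁱ) = (vα, δ₁α + θx^{i+1})` on `Ĉ`. -/
noncomputable def hatX (S : SCData R) : hatC S →ₗ[R] hatC S :=
  LinearMap.prod (S.v ∘ₗ LinearMap.fst R S.Irr.carrier (ℕ →₀ S.Red.carrier))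
    (Finsupp.lsingle 0 ∘ₗ S.δ₁ ∘ₗ LinearMap.fst R S.Irr.carrier (ℕ →₀ S.Red.carrier) +
      Finsupp.lmapDomain S.Red.carrier R (fun i => i + 1) ∘ₗ
        LinearMap.snd R S.Irr.carrier (ℕ →₀ S.Red.carrier))

/-- The small equivariant complex `Č = C ⊕ 𝖱[[x⁻¹,x]/𝖱[x]`, the tail modelled as `ℕ → 𝖱`
(the `m`-th coordinate is the coefficient of `x^{-m-1}`). -/
abbrev checkC (S : SCData R) : Type u := S.Irr.carrier × (ℕ → S.Red.carrier)

/-- The differential `𝔡̌(α, θxⁱ) = (dα, Σ_{j≤-1} δ₁v^{−j−1}(α)xʲ)`. -/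
noncomputable def checkD (S : SCData R) : checkC S →ₗ[R] checkC S :=
  LinearMap.prod (S.d ∘ₗ LinearMap.fst R S.Irr.carrier (ℕ → S.Red.carrier))
    (LinearMap.pi fun m : ℕ =>
      S.δ₁ ∘ₗ lpow S.v m ∘ₗ LinearMap.fst R S.Irr.carrier (ℕ → S.Red.carrier))

/-- The `x`-action on `Č`. -/
noncomputable def checkX (S : SCData R) : checkC S →ₗ[R] checkC S :=
  LinearMap.prod
    (S.v ∘ₗ LinearMap.fst R S.Irr.carrier (ℕ → S.Red.carrier) +
      S.δ₂ ∘ₗ LinearMap.proj 0 ∘ₗ LinearMap.snd R S.Irr.carrier (ℕ → S.Red.carrier))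
    (LinearMap.pi fun m : ℕ =>
      LinearMap.proj (m + 1) ∘ₗ LinearMap.snd R S.Irr.carrier (ℕ → S.Red.carrier))

/-- The module `𝖱[[x⁻¹,x]` of Laurent series with finitely many positive powers, modelled
as (polynomial part, tail): `(ℕ →₀ 𝖱) × (ℕ → 𝖱)`. -/
abbrev barC (S : SCData R) : Type u := (ℕ →₀ S.Red.carrier) × (ℕ → S.Red.carrier)

/-- Multiplication by `x` on `𝖱[[x⁻¹,x]`. -/
noncomputable def barX (S : SCData R) : barC S →ₗ[R] barC S :=
  LinearMap.prod
    (Finsupp.lsingle 0 ∘ₗ LinearMap.proj 0 ∘ₗ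
        LinearMap.snd R (ℕ →₀ S.Red.carrier) (ℕ → S.Red.carrier) +
      Finsupp.lmapDomain S.Red.carrier R (fun i => i + 1) ∘ₗ
        LinearMap.fst R (ℕ →₀ S.Red.carrier) (ℕ → S.Red.carrier))
    (LinearMap.pi fun m : ℕ =>
      LinearMap.proj (m + 1) ∘ₗ LinearMap.snd R (ℕ →₀ S.Red.carrier) (ℕ → S.Red.carrier))

/-- The chain map `𝔦 : Ĉ → 𝖱[[x⁻¹,x]`, `(α, θ) ↦ Σ_{i≤-1} δ₁v^{−i−1}(α)xⁱ + θ`. -/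
noncomputable def mapI (S : SCData R) : hatC S →ₗ[R] barC S :=
  LinearMap.prod (LinearMap.snd R S.Irr.carrier (ℕ →₀ S.Red.carrier))
    (LinearMap.pi fun m : ℕ =>
      S.δ₁ ∘ₗ lpow S.v m ∘ₗ LinearMap.fst R S.Irr.carrier (ℕ →₀ S.Red.carrier))

/-- The chain map `𝔧 : Č → Ĉ`, `(α, ·) ↦ (−α, 0)`. -/
noncomputable def mapJ (S : SCData R) : checkC S →ₗ[R] hatC S :=
  LinearMap.prod (-(LinearMap.fst R S.Irr.carrier (ℕ → S.Red.carrier))) 0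

/-- The chain map `𝔭 : 𝖱[[x⁻¹,x] → Č`, `Σθᵢxⁱ ↦ (Σ_{i≥0} vⁱδ₂θᵢ, Σ_{i≤-1} θᵢxⁱ)`. -/
noncomputable def mapP (S : SCData R) : barC S →ₗ[R] checkC S :=
  LinearMap.prod
    ((Finsupp.lsum ℕ fun i : ℕ => lpow S.v i ∘ₗ S.δ₂) ∘ₗ
      LinearMap.fst R (ℕ →₀ S.Red.carrier) (ℕ → S.Red.carrier))
    (LinearMap.snd R (ℕ →₀ S.Red.carrier) (ℕ → S.Red.carrier))

/-- The coefficient of `xᵉ`, as a linear map `𝖱[[x⁻¹,x] → 𝖱`. -/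
noncomputable def coeffLM (S : SCData R) (e : ℤ) : barC S →ₗ[R] S.Red.carrier :=
  if 0 ≤ e then
    Finsupp.lapply e.toNat ∘ₗ LinearMap.fst R (ℕ →₀ S.Red.carrier) (ℕ → S.Red.carrier)
  else
    LinearMap.proj (-e - 1).toNat ∘ₗ LinearMap.snd R (ℕ →₀ S.Red.carrier) (ℕ → S.Red.carrier)

/-- `𝔍(C~) ⊆ 𝖱[[x⁻¹,x]`, the image of `i⋆ : Ĥ → 𝖱[[x⁻¹,x]` (equal to `𝔦(ker 𝔡̂)`). -/
noncomputable def Jmod (S : SCData R) : Submodule R (barC S) :=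
  (LinearMap.ker (hatD S)).map (mapI S)

/-- `J_i(C~) = { a₀ ∈ 𝖱 | ∃ a₀x^{-i} + a₋₁x^{-i-1} + ⋯ ∈ 𝔍(C~) }`. -/
noncomputable def Jset (S : SCData R) (i : ℤ) : Submodule R S.Red.carrier :=
  ((Jmod S) ⊓ ⨅ (e : ℤ) (_ : -i < e), LinearMap.ker (coeffLM S e)).map (coeffLM S (-i))

/-- The function `d_{C~}(i) = rk_R J_i(C~)`. -/
noncomputable def dFun (S : SCData R) (i : ℤ) : ℕ := Module.finrank R ↥(Jset S i)

/-- An abstract residue calculus on a ring `H`, modelled on the ring of Laurent series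
in `x⁻¹` with coefficients in the (noncommutative) ring `const`. The map `neg` is the projection
to the strictly negative powers of `x` and `res` is the coefficient of `x⁻¹`. -/
structure ResidueCalculus (H : Type*) [Ring H] where
  const : Subring H
  x : H
  neg : H →+ H
  res : H →+ H
  x_comm : ∀ y, x * y = y * x
  neg_const_mul : ∀ a ∈ const, ∀ y, neg (a * y) = a * neg y
  neg_mul_const : ∀ a ∈ const, ∀ y, neg (y * a) = neg y * a
  neg_neg : ∀ y, neg (neg y) = neg y
  neg_x_mul : ∀ y, neg (x * y) = x * neg y - res y
  res_mem : ∀ y, res y ∈ const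
  res_neg : ∀ y, res (neg y) = res y
  neg_mul_neg : ∀ y z, neg (neg y * neg z) = neg y * neg z
  res_neg_mul_neg : ∀ y z, res (neg y * neg z) = 0
  neg_pos_mul_pos : ∀ y z, neg ((y - neg y) * (z - neg z)) = 0

namespace ResidueCalculus

variable {H : Type*} [Ring H] (L : ResidueCalculus H)

lemma res_const_mul {a : H} (ha : a ∈ L.const) (y : H) : L.res (a * y) = a * L.res y := by
  have h1 := L.neg_x_mul (a * y)
  have h2 := L.neg_x_mul y
  have h3 : L.x * (a * y) = a * (L.x * y) := by rw [← mul_assoc, L.x_comm a, mul_assoc]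
  rw [h3, L.neg_const_mul a ha, L.neg_const_mul a ha, h2, ← mul_assoc, L.x_comm a] at h1
  linear_combination (norm := noncomm_ring) h1

lemma res_mul_const {a : H} (ha : a ∈ L.const) (y : H) : L.res (y * a) = L.res y * a := by
  have h1 := L.neg_x_mul (y * a)
  have h2 := L.neg_x_mul y
  rw [← mul_assoc, L.neg_mul_const a ha, L.neg_mul_const a ha, h2] at h1
  linear_combination (norm := noncomm_ring) h1

lemma res_pos_mul_pos (y z : H) : L.res ((y - L.neg y) * (z - L.neg z)) = 0 := by
  rw [← L.res_neg, L.neg_pos_mul_pos, map_zero]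

/-- Splitting the residue of a product along negative parts. -/
lemma res_mul_split (y z : H) : L.res (y * z) = L.res (L.neg y * z) + L.res (y * L.neg z) := by
  have h1 := L.res_pos_mul_pos y z
  have h2 := L.res_neg_mul_neg y z
  simp only [sub_mul, mul_sub, map_sub] at h1
  rw [h2] at h1
  linear_combination (norm := abel) h1

/-- Splitting the negative part of a product along negative parts. -/
lemma neg_mul_split (y z : H) :
    L.neg (y * z) = L.neg (L.neg y * z) + L.neg (y * L.neg z) - L.neg y * L.neg z := by
  have h1 := L.neg_pos_mul_pos y z
  have h2 := L.neg_mul_neg y z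
  simp only [sub_mul, mul_sub, map_sub] at h1
  rw [h2] at h1
  linear_combination (norm := abel) h1

/-- An `S`-complex with vanishing `r` inside a residue calculus; `P` is the resolvent
`(x - v)⁻¹`. -/
structure Cpx where
  d : H
  v : H
  δ₁ : H
  δ₂ : H
  P : H
  d_mem : d ∈ L.const
  v_mem : v ∈ L.const
  δ₁_mem : δ₁ ∈ L.const
  δ₂_mem : δ₂ ∈ L.const
  neg_P : L.neg P = P
  P_mul : P * (L.x - v) = 1
  mul_P : (L.x - v) * P = 1
  δ₁_d : δ₁ * d = 0
  d_δ₂ : d * δ₂ = 0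
  d_v : d * v - v * d = δ₂ * δ₁
  perfect : δ₁ * P * δ₂ = 0

namespace Cpx

variable {L} (S : L.Cpx)

lemma d_P : S.d * S.P - S.P * S.d = S.P * S.δ₂ * S.δ₁ * S.P := by
  have h1 := S.P_mul
  have h2 := S.mul_P
  have h4 := L.x_comm S.d
  have h3 : (L.x - S.v) * S.d - S.d * (L.x - S.v) = S.δ₂ * S.δ₁ := by
    rw [← S.d_v]; linear_combination (norm := noncomm_ring) h4
  calc S.d * S.P - S.P * S.d
      = (S.P * (L.x - S.v)) * S.d * S.P - S.P * S.d * ((L.x - S.v) * S.P) := by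
        rw [h1, h2]; noncomm_ring
    _ = S.P * ((L.x - S.v) * S.d - S.d * (L.x - S.v)) * S.P := by noncomm_ring
    _ = _ := by rw [h3]; noncomm_ring

lemma δ₁_P_d : S.δ₁ * S.P * S.d = 0 := by
  linear_combination (norm := noncomm_ring)
    S.δ₁_d * S.P - S.δ₁ * S.d_P - S.perfect * S.δ₁ * S.P

lemma d_P_δ₂ : S.d * S.P * S.δ₂ = 0 := by
  linear_combination (norm := noncomm_ring)
    S.P * S.d_δ₂ + S.d_P * S.δ₂ + S.P * S.δ₂ * S.perfect

/-- Multiplying a residue by the resolvent computes a negative part. -/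
lemma res_mul_P (y : H) : L.res (y * S.P) * S.P = L.neg ((y - L.neg y) * S.P) := by
  set g := y - L.neg y with hg
  have hres : L.res (y * S.P) = L.res (g * S.P) := by
    have := L.res_neg_mul_neg y S.P
    rw [S.neg_P] at this
    rw [hg, sub_mul, map_sub, this, sub_zero]
  have hg0 : L.neg g = 0 := by rw [hg, map_sub, L.neg_neg, sub_self]
  have h1 := L.neg_x_mul (g * S.P)
  have h2 : L.x * (g * S.P) = g + g * S.P * S.v := by
    rw [L.x_comm]; linear_combination (norm := noncomm_ring) g * S.P_mul
  rw [h2, map_add, hg0, L.neg_mul_const _ S.v_mem, L.x_comm] at h1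
  rw [hres]
  linear_combination (norm := noncomm_ring)
    h1 * S.P + L.neg (g * S.P) * S.mul_P

/-- Multiplying a residue by the resolvent computes a negative part. -/
lemma P_mul_res (y : H) : S.P * L.res (S.P * y) = L.neg (S.P * (y - L.neg y)) := by
  set g := y - L.neg y with hg
  have hres : L.res (S.P * y) = L.res (S.P * g) := by
    have := L.res_neg_mul_neg S.P y
    rw [S.neg_P] at this
    rw [hg, mul_sub, map_sub, this, sub_zero]
  have hg0 : L.neg g = 0 := by rw [hg, map_sub, L.neg_neg, sub_self]
  have h1 := L.neg_x_mul (S.P * g)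
  have h2 : L.x * (S.P * g) = g + S.v * (S.P * g) := by
    linear_combination (norm := noncomm_ring) S.mul_P * g
  rw [h2, map_add, hg0, L.neg_const_mul _ S.v_mem] at h1
  rw [hres]
  linear_combination (norm := noncomm_ring)
    S.P * h1 + S.P_mul * L.neg (S.P * g)

lemma neg_mul_P (y : H) : L.neg (y * S.P) = L.neg y * S.P + L.res (y * S.P) * S.P := by
  have h := L.neg_mul_neg y S.P
  rw [S.neg_P] at h
  rw [S.res_mul_P, sub_mul, map_sub, h]
  abel

lemma neg_P_mul (y : H) : L.neg (S.P * y) = S.P * L.neg y + S.P * L.res (S.P * y) := by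
  have h := L.neg_mul_neg S.P y
  rw [S.neg_P] at h
  rw [S.P_mul_res, mul_sub, map_sub, h]
  abel

end Cpx

/-- The components of a height morphism inside a residue calculus; the maps `τ_i` are assembled
into the generating series `tau = ∑ τ_i x⁻ⁱ`. -/
structure MorData (H : Type*) where
  lam : H
  mu : H
  del1 : H
  del2 : H
  tau : H

variable {L}

lemma neg_mul_P_mul (S T : L.Cpx) {mu del1 del2 : H} (hmu : mu ∈ L.const)
    (hdel1 : del1 ∈ L.const) (hdel2 : del2 ∈ L.const) :
    L.neg (T.δ₁ * T.P * del2 + del1 * S.P * S.δ₂ + T.δ₁ * T.P * mu * S.P * S.δ₂) =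
      T.δ₁ * T.P * del2 + del1 * S.P * S.δ₂ + T.δ₁ * T.P * mu * S.P * S.δ₂ := by
  have h : L.neg (T.δ₁ * T.P * mu) = T.δ₁ * T.P * mu := by
    rw [L.neg_mul_const _ hmu, L.neg_const_mul _ T.δ₁_mem, T.neg_P]
  have hP := L.neg_mul_neg (T.δ₁ * T.P * mu) S.P
  rw [h, S.neg_P] at hP
  rw [map_add, map_add, L.neg_mul_const _ hdel2, L.neg_mul_const _ S.δ₂_mem,
    L.neg_mul_const _ S.δ₂_mem, L.neg_const_mul _ T.δ₁_mem, L.neg_const_mul _ hdel1, hP, T.neg_P,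
    S.neg_P]

/-- The relations of a height morphism, in residue form. -/
structure IsMor (S T : L.Cpx) (f : MorData H) : Prop where
  lam_mem : f.lam ∈ L.const
  mu_mem : f.mu ∈ L.const
  del1_mem : f.del1 ∈ L.const
  del2_mem : f.del2 ∈ L.const
  neg_tau : L.neg f.tau = T.δ₁ * T.P * f.del2 + f.del1 * S.P * S.δ₂ +
    T.δ₁ * T.P * f.mu * S.P * S.δ₂
  d_lam : T.d * f.lam - f.lam * S.d = L.res (T.P * T.δ₂ * f.tau * S.δ₁ * S.P)
  δ₁_lam : T.δ₁ * f.lam - f.del1 * S.d = L.res (f.tau * S.δ₁ * S.P)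
  lam_δ₂ : f.lam * S.δ₂ + T.d * f.del2 = L.res (T.P * T.δ₂ * f.tau)
  mu_d : f.mu * S.d + T.d * f.mu + f.lam * S.v - T.v * f.lam + f.del2 * S.δ₁
    - T.δ₂ * f.del1 = 0

/-- The composition of height morphisms, in residue form. -/
def MorData.comp (S T U : L.Cpx) (g f : MorData H) : MorData H where
  lam := g.lam * f.lam + L.res (U.P * U.δ₂ * g.tau * f.del1 * S.P)
    + L.res (U.P * g.del2 * f.tau * S.δ₁ * S.P)
    + L.res (U.P * U.δ₂ * g.tau * T.δ₁ * T.P * f.mu * S.P)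
    + L.res (U.P * g.mu * T.P * T.δ₂ * f.tau * S.δ₁ * S.P)
  mu := g.lam * f.mu + g.mu * f.lam + g.del2 * f.del1
  del1 := g.del1 * f.lam + L.res (g.tau * f.del1 * S.P)
    + L.res (g.tau * T.δ₁ * T.P * f.mu * S.P)
  del2 := g.lam * f.del2 + L.res (U.P * g.del2 * f.tau)
    + L.res (U.P * g.mu * T.P * T.δ₂ * f.tau)
  tau := g.tau * f.tau

namespace IsMor

variable {S T U : L.Cpx} {f g : MorData H}


lemma del1_P_d (hf : IsMor S T f) : (f.del1 + T.δ₁ * T.P * f.mu) * S.P * S.d =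
    T.δ₁ * T.P * f.lam - L.neg (f.tau * S.δ₁ * S.P) := by
  rw [S.neg_mul_P, L.neg_mul_const _ S.δ₁_mem]
  linear_combination (norm := noncomm_ring)
    -(f.del1 + T.δ₁ * T.P * f.mu) * S.d_P + hf.neg_tau * S.δ₁ * S.P - hf.δ₁_lam * S.P
    + T.δ₁ * T.P * hf.mu_d * S.P - T.δ₁_P_d * f.mu * S.P + T.perfect * f.del1 * S.P
    + T.δ₁ * T.P * f.lam * S.mul_P - T.δ₁ * T.P_mul * f.lam * S.P
    + T.δ₁ * T.P * L.x_comm f.lam * S.P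

lemma d_P_del2 (hf : IsMor S T f) : T.d * T.P * (f.del2 + f.mu * S.P * S.δ₂) =
    L.neg (T.P * T.δ₂ * f.tau) - f.lam * S.P * S.δ₂ := by
  rw [mul_assoc T.P, T.neg_P_mul, L.neg_const_mul _ T.δ₂_mem, ← mul_assoc T.P T.δ₂ f.tau]
  linear_combination (norm := noncomm_ring)
    T.d_P * (f.del2 + f.mu * S.P * S.δ₂) - T.P * T.δ₂ * hf.neg_tau + T.P * hf.lam_δ₂
    + T.P * hf.mu_d * S.P * S.δ₂ - T.P * f.mu * S.d_P_δ₂ - T.P * f.del2 * S.perfect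
    + T.P * f.lam * S.mul_P * S.δ₂ - T.P_mul * f.lam * S.P * S.δ₂
    + T.P * L.x_comm f.lam * S.P * S.δ₂

lemma comp_lam (S T U : L.Cpx) (g f : MorData H) : (MorData.comp S T U g f).lam = g.lam * f.lam
    + L.res (U.P * U.δ₂ * g.tau * ((f.del1 + T.δ₁ * T.P * f.mu) * S.P))
    + L.res (U.P * (g.del2 + g.mu * T.P * T.δ₂) * (f.tau * S.δ₁ * S.P)) := by
  simp only [MorData.comp, mul_add, add_mul, map_add, mul_assoc]
  abel

lemma comp_del1 (S T U : L.Cpx) (g f : MorData H) : (MorData.comp S T U g f).del1 =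
    g.del1 * f.lam + L.res (g.tau * ((f.del1 + T.δ₁ * T.P * f.mu) * S.P)) := by
  simp only [MorData.comp, mul_add, add_mul, map_add, mul_assoc, add_assoc]

lemma comp_del2 (S T U : L.Cpx) (g f : MorData H) : (MorData.comp S T U g f).del2 =
    g.lam * f.del2 + L.res (U.P * (g.del2 + g.mu * T.P * T.δ₂) * f.tau) := by
  simp only [MorData.comp, mul_add, add_mul, map_add, mul_assoc, add_assoc]

lemma comp_δ₁_lam (hf : IsMor S T f) (hg : IsMor T U g) :
    U.δ₁ * (MorData.comp S T U g f).lam - (MorData.comp S T U g f).del1 * S.d =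
      L.res ((MorData.comp S T U g f).tau * S.δ₁ * S.P) := by
  rw [comp_lam, comp_del1]
  set Y := f.tau * S.δ₁ * S.P with hY
  set A := (f.del1 + T.δ₁ * T.P * f.mu) * S.P with hA
  have e1 : U.δ₁ * L.res (U.P * U.δ₂ * g.tau * A) = 0 := by
    rw [← L.res_const_mul U.δ₁_mem, show U.δ₁ * (U.P * U.δ₂ * g.tau * A) = 0 by
      linear_combination (norm := noncomm_ring) U.perfect * g.tau * A, map_zero]
  have e2 : U.δ₁ * L.res (U.P * (g.del2 + g.mu * T.P * T.δ₂) * Y) =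
      L.res (L.neg g.tau * Y) - g.del1 * L.res (T.P * T.δ₂ * Y) := by
    rw [← L.res_const_mul U.δ₁_mem, ← L.res_const_mul hg.del1_mem, ← map_sub]
    congr 1
    linear_combination (norm := (simp only [hY]; noncomm_ring)) -hg.neg_tau * Y
  have e3 : L.res (g.tau * A) * S.d =
      L.res (g.tau * T.δ₁ * T.P) * f.lam - L.res (g.tau * L.neg Y) := by
    rw [← L.res_mul_const S.d_mem, ← L.res_mul_const hf.lam_mem, ← map_sub]
    congr 1
    linear_combination (norm := (simp only [hY, hA]; noncomm_ring)) g.tau * hf.del1_P_d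
  have e4 : L.res ((MorData.comp S T U g f).tau * S.δ₁ * S.P) = L.res (g.tau * Y) := by
    simp only [MorData.comp, hY, mul_assoc]
  have e5 := hf.d_lam
  rw [show T.P * T.δ₂ * f.tau * S.δ₁ * S.P = T.P * T.δ₂ * Y by simp only [hY, mul_assoc]] at e5
  rw [e4, L.res_mul_split g.tau Y]
  linear_combination (norm := (simp only [hY, hA]; noncomm_ring)) e1 + e2 - e3 + hg.δ₁_lam * f.lam + g.del1 * e5

lemma comp_lam_δ₂ (hf : IsMor S T f) (hg : IsMor T U g) :
    (MorData.comp S T U g f).lam * S.δ₂ + U.d * (MorData.comp S T U g f).del2 =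
      L.res (U.P * U.δ₂ * (MorData.comp S T U g f).tau) := by
  rw [comp_lam, comp_del2]
  set Y := U.P * U.δ₂ * g.tau with hY
  set B := U.P * (g.del2 + g.mu * T.P * T.δ₂) with hB
  have e1 : L.res (B * (f.tau * S.δ₁ * S.P)) * S.δ₂ = 0 := by
    rw [← L.res_mul_const S.δ₂_mem, show B * (f.tau * S.δ₁ * S.P) * S.δ₂ = 0 by
      linear_combination (norm := noncomm_ring) B * f.tau * S.perfect, map_zero]
  have e2 : L.res (Y * ((f.del1 + T.δ₁ * T.P * f.mu) * S.P)) * S.δ₂ =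
      L.res (Y * L.neg f.tau) - L.res (Y * T.δ₁ * T.P) * f.del2 := by
    rw [← L.res_mul_const S.δ₂_mem, ← L.res_mul_const hf.del2_mem, ← map_sub]
    congr 1
    linear_combination (norm := (simp only [hY]; noncomm_ring)) -Y * hf.neg_tau
  have e3 : U.d * L.res (B * f.tau) =
      L.res (L.neg Y * f.tau) - g.lam * L.res (T.P * T.δ₂ * f.tau) := by
    rw [← L.res_const_mul U.d_mem, ← L.res_const_mul hg.lam_mem, ← map_sub]
    congr 1
    linear_combination (norm := (simp only [hY, hB]; noncomm_ring)) hg.d_P_del2 * f.tau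
  have e4 : L.res (U.P * U.δ₂ * (MorData.comp S T U g f).tau) = L.res (Y * f.tau) := by
    simp only [MorData.comp, hY, mul_assoc]
  rw [e4, L.res_mul_split Y f.tau]
  linear_combination (norm := (simp only [hY, hB]; noncomm_ring))
    e1 + e2 + e3 + hg.d_lam * f.del2 + g.lam * hf.lam_δ₂

lemma comp_d_lam (hf : IsMor S T f) (hg : IsMor T U g) :
    U.d * (MorData.comp S T U g f).lam - (MorData.comp S T U g f).lam * S.d =
      L.res (U.P * U.δ₂ * (MorData.comp S T U g f).tau * S.δ₁ * S.P) := by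
  rw [comp_lam]
  set A := (f.del1 + T.δ₁ * T.P * f.mu) * S.P with hA
  set B := U.P * (g.del2 + g.mu * T.P * T.δ₂) with hB
  set Y := U.P * U.δ₂ * g.tau with hY
  set Z := f.tau * S.δ₁ * S.P with hZ
  have e1 : U.d * L.res (Y * A) = 0 := by
    rw [← L.res_const_mul U.d_mem, show U.d * (Y * A) = 0 by
      linear_combination (norm := (simp only [hY]; noncomm_ring)) U.d_P_δ₂ * g.tau * A, map_zero]
  have e2 : L.res (B * Z) * S.d = 0 := by
    rw [← L.res_mul_const S.d_mem, show B * Z * S.d = 0 by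
      linear_combination (norm := (simp only [hZ]; noncomm_ring)) B * f.tau * S.δ₁_P_d, map_zero]
  have e3 : U.d * L.res (B * Z) = L.res (L.neg Y * Z) - g.lam * L.res (T.P * T.δ₂ * Z) := by
    rw [← L.res_const_mul U.d_mem, ← L.res_const_mul hg.lam_mem, ← map_sub]
    congr 1
    linear_combination (norm := (simp only [hB, hY, hZ]; noncomm_ring)) hg.d_P_del2 * Z
  have e4 : L.res (Y * A) * S.d = L.res (Y * T.δ₁ * T.P) * f.lam - L.res (Y * L.neg Z) := by
    rw [← L.res_mul_const S.d_mem, ← L.res_mul_const hf.lam_mem, ← map_sub]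
    congr 1
    linear_combination (norm := (simp only [hA, hY, hZ]; noncomm_ring)) Y * hf.del1_P_d
  have e5 : L.res (U.P * U.δ₂ * (MorData.comp S T U g f).tau * S.δ₁ * S.P) = L.res (Y * Z) := by
    simp only [MorData.comp, hY, hZ, mul_assoc]
  have e6 := hf.d_lam
  rw [show T.P * T.δ₂ * f.tau * S.δ₁ * S.P = T.P * T.δ₂ * Z by simp only [hZ, mul_assoc]] at e6
  rw [e5, L.res_mul_split Y Z]
  linear_combination (norm := (simp only [hA, hB, hY, hZ]; noncomm_ring))
    e1 - e2 + e3 - e4 + hg.d_lam * f.lam + g.lam * e6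

lemma comp_mu_d (hf : IsMor S T f) (hg : IsMor T U g) :
    (MorData.comp S T U g f).mu * S.d + U.d * (MorData.comp S T U g f).mu
      + (MorData.comp S T U g f).lam * S.v - U.v * (MorData.comp S T U g f).lam
      + (MorData.comp S T U g f).del2 * S.δ₁ - U.δ₂ * (MorData.comp S T U g f).del1 = 0 := by
  rw [comp_lam, comp_del1, comp_del2, MorData.comp]
  set A := (f.del1 + T.δ₁ * T.P * f.mu) * S.P with hA
  set B := U.P * (g.del2 + g.mu * T.P * T.δ₂) with hB
  set Y := U.P * U.δ₂ * g.tau with hY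
  set Z := f.tau * S.δ₁ * S.P with hZ
  have e1 : L.res (Y * A) * S.v - U.v * L.res (Y * A) = U.δ₂ * L.res (g.tau * A)
      - L.res (U.P * U.δ₂ * g.tau) * f.del1 - L.res (U.P * U.δ₂ * g.tau * T.δ₁ * T.P) * f.mu := by
    rw [← L.res_mul_const S.v_mem, ← L.res_const_mul U.v_mem, ← L.res_const_mul U.δ₂_mem,
      ← L.res_mul_const hf.del1_mem, ← L.res_mul_const hf.mu_mem, ← map_sub, ← map_sub, ← map_sub]
    congr 1
    linear_combination (norm := (simp only [hA, hY]; noncomm_ring)) -Y * (f.del1 + T.δ₁ * T.P * f.mu) * S.P_mul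
      + U.mul_P * U.δ₂ * g.tau * A - L.x_comm (Y * A)
  have e2 : L.res (B * Z) * S.v - U.v * L.res (B * Z) = g.del2 * L.res (f.tau * S.δ₁ * S.P)
      + g.mu * L.res (T.P * T.δ₂ * f.tau * S.δ₁ * S.P) - L.res (B * f.tau) * S.δ₁ := by
    rw [← L.res_mul_const S.v_mem, ← L.res_const_mul U.v_mem, ← L.res_const_mul hg.del2_mem,
      ← L.res_const_mul hg.mu_mem, ← L.res_mul_const S.δ₁_mem, ← map_sub, ← map_add, ← map_sub]
    congr 1
    linear_combination (norm := (simp only [hB, hZ]; noncomm_ring)) -B * f.tau * S.δ₁ * S.P_mul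
      + U.mul_P * (g.del2 + g.mu * T.P * T.δ₂) * Z - L.x_comm (B * Z)
  rw [← hf.δ₁_lam, ← hf.d_lam] at e2
  rw [← hg.lam_δ₂, ← hg.d_lam] at e1
  linear_combination (norm := (simp only [hA, hB, hY, hZ]; noncomm_ring))
    e1 + e2 + g.lam * hf.mu_d + hg.mu_d * f.lam

lemma comp_neg_tau (hf : IsMor S T f) (hg : IsMor T U g) :
    L.neg (MorData.comp S T U g f).tau = U.δ₁ * U.P * (MorData.comp S T U g f).del2
      + (MorData.comp S T U g f).del1 * S.P * S.δ₂
      + U.δ₁ * U.P * (MorData.comp S T U g f).mu * S.P * S.δ₂ := by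
  rw [comp_del1, comp_del2, MorData.comp, L.neg_mul_split g.tau f.tau]
  set M := L.neg (T.P * T.δ₂ * f.tau) with hM
  set N := L.neg (g.tau * T.δ₁ * T.P) with hN
  have e1 : U.δ₁ * U.P * L.res (U.P * (g.del2 + g.mu * T.P * T.δ₂) * f.tau) =
      L.neg (L.neg g.tau * f.tau) - g.del1 * M
        - U.δ₁ * U.P * (g.del2 * L.neg f.tau + g.mu * M) := by
    have k1 := U.neg_P_mul ((g.del2 + g.mu * T.P * T.δ₂) * f.tau)
    rw [← mul_assoc] at k1
    have k2 : U.δ₁ * L.neg (U.P * (g.del2 + g.mu * T.P * T.δ₂) * f.tau) =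
        L.neg (L.neg g.tau * f.tau) - g.del1 * M := by
      rw [hM, ← L.neg_const_mul _ U.δ₁_mem, ← L.neg_const_mul _ hg.del1_mem, ← map_sub]
      congr 1
      linear_combination (norm := noncomm_ring) -hg.neg_tau * f.tau
    have k3 : L.neg ((g.del2 + g.mu * T.P * T.δ₂) * f.tau) = g.del2 * L.neg f.tau + g.mu * M := by
      rw [hM, ← L.neg_const_mul _ hg.del2_mem, ← L.neg_const_mul _ hg.mu_mem, ← map_add]
      congr 1
      noncomm_ring
    rw [k3] at k1
    generalize L.res (U.P * (g.del2 + g.mu * T.P * T.δ₂) * f.tau) = r at *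
    generalize L.neg (U.P * (g.del2 + g.mu * T.P * T.δ₂) * f.tau) = w at *
    linear_combination (norm := noncomm_ring) -U.δ₁ * k1 + k2
  have e2 : L.res (g.tau * ((f.del1 + T.δ₁ * T.P * f.mu) * S.P)) * S.P * S.δ₂ =
      L.neg (g.tau * L.neg f.tau) - N * f.del2
        - (L.neg g.tau * f.del1 + N * f.mu) * S.P * S.δ₂ := by
    have k1 := S.neg_mul_P (g.tau * (f.del1 + T.δ₁ * T.P * f.mu))
    rw [mul_assoc g.tau] at k1
    have k2 : L.neg (g.tau * ((f.del1 + T.δ₁ * T.P * f.mu) * S.P)) * S.δ₂ =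
        L.neg (g.tau * L.neg f.tau) - N * f.del2 := by
      rw [hN, ← L.neg_mul_const _ S.δ₂_mem, ← L.neg_mul_const _ hf.del2_mem, ← map_sub]
      congr 1
      linear_combination (norm := noncomm_ring) -g.tau * hf.neg_tau
    have k3 : L.neg (g.tau * (f.del1 + T.δ₁ * T.P * f.mu)) = L.neg g.tau * f.del1 + N * f.mu := by
      rw [hN, ← L.neg_mul_const _ hf.del1_mem, ← L.neg_mul_const _ hf.mu_mem, ← map_add]
      congr 1
      noncomm_ring
    rw [k3] at k1
    generalize L.res (g.tau * ((f.del1 + T.δ₁ * T.P * f.mu) * S.P)) = r at *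
    generalize L.neg (g.tau * ((f.del1 + T.δ₁ * T.P * f.mu) * S.P)) = w at *
    linear_combination (norm := noncomm_ring) -k1 * S.δ₂ + k2
  have e3 := hg.del1_P_d
  have e4 := hf.d_P_del2
  rw [← hN] at e3
  rw [← hM] at e4
  clear_value M N
  linear_combination (norm := noncomm_ring) -e1 - e2 + e3 * (f.del2 + f.mu * S.P * S.δ₂)
    - (g.del1 + U.δ₁ * U.P * g.mu) * e4
    + (g.del1 + U.δ₁ * U.P * g.mu) * T.d_P * (f.del2 + f.mu * S.P * S.δ₂)
    - hg.neg_tau * (L.neg f.tau - f.del1 * S.P * S.δ₂)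
    - (g.del1 + U.δ₁ * U.P * g.mu) * T.P * T.δ₂ * hf.neg_tau

theorem comp (hf : IsMor S T f) (hg : IsMor T U g) : IsMor S U (MorData.comp S T U g f) where
  lam_mem := by
    rw [comp_lam]
    exact add_mem (add_mem (mul_mem hg.lam_mem hf.lam_mem) (L.res_mem _)) (L.res_mem _)
  mu_mem := add_mem (add_mem (mul_mem hg.lam_mem hf.mu_mem) (mul_mem hg.mu_mem hf.lam_mem))
    (mul_mem hg.del2_mem hf.del1_mem)
  del1_mem := by
    rw [comp_del1]
    exact add_mem (mul_mem hg.del1_mem hf.lam_mem) (L.res_mem _)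
  del2_mem := by
    rw [comp_del2]
    exact add_mem (mul_mem hg.lam_mem hf.del2_mem) (L.res_mem _)
  neg_tau := comp_neg_tau hf hg
  d_lam := comp_d_lam hf hg
  δ₁_lam := comp_δ₁_lam hf hg
  lam_δ₂ := comp_lam_δ₂ hf hg
  mu_d := comp_mu_d hf hg

end IsMor

end ResidueCalculus

section LaurentResidue

open HahnSeries

variable {A : Type*} [Ring A]

namespace HahnSeries

lemma coeff_mul_eq_zero_of_forall {y z : HahnSeries ℤ A} {c : ℤ}
    (h : ∀ i j, i + j = c → y.coeff i = 0 ∨ z.coeff j = 0) : (y * z).coeff c = 0 := by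
  rw [coeff_mul]
  refine Finset.sum_eq_zero fun ij hij => ?_
  rw [Finset.mem_antidiagonal] at hij
  rcases h _ _ hij.2.2 with h | h <;> simp [h]

/-- The part of a Laurent series of positive exponent. -/
noncomputable def posPart (y : HahnSeries ℤ A) : HahnSeries ℤ A := y - truncLT 1 y

lemma coeff_posPart (y : HahnSeries ℤ A) (i : ℤ) :
    (posPart y).coeff i = if 0 < i then y.coeff i else 0 := by
  rw [posPart, coeff_sub, HahnSeries.coeff_truncLT]
  split_ifs <;> first | omega | simp

lemma posPart_eq_iff {y z : HahnSeries ℤ A} (hz : posPart z = z) :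
    posPart y = z ↔ ∀ i : ℕ, y.coeff ((i : ℤ) + 1) = z.coeff ((i : ℤ) + 1) := by
  rw [← hz]
  refine ⟨fun h i => ?_, fun h => ?_⟩
  · have hi := congrArg (fun w => w.coeff ((i : ℤ) + 1)) h
    rwa [coeff_posPart, if_pos (by omega)] at hi
  · ext i
    rw [coeff_posPart]
    split_ifs with hi
    · obtain ⟨j, rfl⟩ : ∃ j : ℕ, i = j + 1 := ⟨(i - 1).toNat, by omega⟩
      exact h j
    · rw [coeff_posPart, if_neg hi]

lemma coeff_sub_posPart (y : HahnSeries ℤ A) (i : ℤ) :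
    (y - posPart y).coeff i = if 0 < i then 0 else y.coeff i := by
  rw [coeff_sub, coeff_posPart]
  split_ifs <;> simp

lemma coeff_C_mul (a : A) (y : HahnSeries ℤ A) (i : ℤ) : (C a * y).coeff i = a * y.coeff i :=
  coeff_single_zero_mul

lemma coeff_mul_C (a : A) (y : HahnSeries ℤ A) (i : ℤ) : (y * C a).coeff i = y.coeff i * a :=
  coeff_mul_single_zero

lemma single_one_mul_comm (b : ℤ) (y : HahnSeries ℤ A) :
    single b 1 * y = y * single b 1 := by
  ext i
  rw [coeff_single_mul, coeff_mul_single, one_mul, mul_one]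

/-- The residue calculus on Laurent series in `x⁻¹`, where `x = single (-1) 1`. -/
noncomputable def residueCalculus (A : Type*) [Ring A] : ResidueCalculus (HahnSeries ℤ A) where
  const := (C : A →+* HahnSeries ℤ A).range
  x := single (-1) 1
  neg :=
    { toFun := posPart
      map_zero' := by simp [posPart]
      map_add' := fun y z => by simp only [posPart, truncLT_add]; abel }
  res :=
    { toFun := fun y => C (y.coeff 1)
      map_zero' := by simp
      map_add' := fun y z => by simp }
  x_comm := single_one_mul_comm _
  neg_const_mul := by
    rintro _ ⟨a, rfl⟩ y
    ext i
    simp only [AddMonoidHom.coe_mk, ZeroHom.coe_mk, coeff_posPart, coeff_C_mul, mul_ite, mul_zero]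
  neg_mul_const := by
    rintro _ ⟨a, rfl⟩ y
    ext i
    simp only [AddMonoidHom.coe_mk, ZeroHom.coe_mk, coeff_posPart, coeff_mul_C, ite_mul, zero_mul]
  neg_neg y := by
    ext i
    simp only [AddMonoidHom.coe_mk, ZeroHom.coe_mk, coeff_posPart]
    split_ifs <;> rfl
  neg_x_mul y := by
    ext i
    simp only [AddMonoidHom.coe_mk, ZeroHom.coe_mk, coeff_sub, coeff_posPart, coeff_single_mul,
      one_mul, C_apply, coeff_single]
    rcases lt_trichotomy i 0 with h | rfl | h
    · rw [if_neg (by omega), if_neg (by omega), if_neg (by omega), sub_zero]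
    · simp
    · rw [if_pos h, if_pos (by omega), if_neg (by omega), sub_zero]
  res_mem y := ⟨_, rfl⟩
  res_neg y := by
    simp only [AddMonoidHom.coe_mk, ZeroHom.coe_mk, coeff_posPart, zero_lt_one, if_true]
  neg_mul_neg y z := by
    ext i
    simp only [AddMonoidHom.coe_mk, ZeroHom.coe_mk]
    rw [coeff_posPart]
    split_ifs with hi
    · rfl
    · symm
      refine coeff_mul_eq_zero_of_forall fun a b hab => ?_
      simp only [coeff_posPart]
      by_cases ha : 0 < a
      · right; rw [if_neg (by omega)]
      · left; rw [if_neg ha]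
  res_neg_mul_neg y z := by
    simp only [AddMonoidHom.coe_mk, ZeroHom.coe_mk]
    rw [coeff_mul_eq_zero_of_forall, map_zero]
    intro a b hab
    simp only [coeff_posPart]
    by_cases ha : 0 < a
    · right; rw [if_neg (by omega)]
    · left; rw [if_neg ha]
  neg_pos_mul_pos y z := by
    ext i
    simp only [AddMonoidHom.coe_mk, ZeroHom.coe_mk]
    rw [coeff_posPart, coeff_zero]
    split_ifs with hi
    · refine coeff_mul_eq_zero_of_forall fun a b hab => ?_
      simp only [coeff_sub_posPart]
      by_cases ha : 0 < a
      · left; rw [if_pos ha]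
      · right; rw [if_pos (by omega)]
    · rfl

lemma residueCalculus_res (y : HahnSeries ℤ A) :
    (residueCalculus A).res y = C (y.coeff 1) := rfl

lemma C_mem_residueCalculus_const (a : A) : C a ∈ (residueCalculus A).const := ⟨a, rfl⟩

/-- The geometric series `∑ vⁱ tⁱ`. -/
abbrev geom (v : A) : PowerSeries A := PowerSeries.mk (v ^ ·)

lemma geom_mul (v : A) : geom v * (1 - PowerSeries.X * PowerSeries.C v) = 1 := by
  ext i
  rw [mul_sub, mul_one, ← mul_assoc]
  cases i with
  | zero => simp
  | succ i => simp [PowerSeries.coeff_one, pow_succ, PowerSeries.coeff_succ_mul_X]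

lemma mul_geom (v : A) : (1 - PowerSeries.X * PowerSeries.C v) * geom v = 1 := by
  ext i
  rw [sub_mul, one_mul, mul_assoc]
  cases i with
  | zero => simp
  | succ i => simp [PowerSeries.coeff_one, pow_succ', PowerSeries.coeff_succ_X_mul]

/-- The resolvent `(x - v)⁻¹ = ∑ vⁱ x⁻ⁱ⁻¹`. -/
noncomputable def resolvent (v : A) : HahnSeries ℤ A :=
  single 1 1 * ofPowerSeries ℤ A (geom v)

lemma x_sub_C (v : A) : (single (-1) 1 - C v : HahnSeries ℤ A) =
    single (-1) 1 * ofPowerSeries ℤ A (1 - PowerSeries.X * PowerSeries.C v) := by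
  rw [map_sub (ofPowerSeries ℤ A), map_one (ofPowerSeries ℤ A), map_mul, ofPowerSeries_X,
    ofPowerSeries_C, mul_sub, mul_one, ← mul_assoc, single_mul_single]
  simp [single_zero_one]

lemma resolvent_mul (v : A) : resolvent v * (single (-1) 1 - C v) = 1 := by
  rw [x_sub_C, resolvent, single_one_mul_comm, mul_assoc, ← mul_assoc (single 1 1),
    single_mul_single, add_neg_cancel, one_mul, single_zero_one, one_mul, ← map_mul, geom_mul,
    map_one]

lemma mul_resolvent (v : A) : (single (-1) 1 - C v) * resolvent v = 1 := by
  rw [x_sub_C, resolvent, single_one_mul_comm (-1), mul_assoc, ← mul_assoc (single (-1) 1),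
    single_mul_single, neg_add_cancel, one_mul, single_zero_one, one_mul, ← map_mul, mul_geom,
    map_one]

lemma coeff_ofPowerSeries_of_neg (p : PowerSeries A) {i : ℤ} (hi : i < 0) :
    (ofPowerSeries ℤ A p).coeff i = 0 := by
  rw [ofPowerSeries_apply]
  refine embDomain_of_notMem_range ?_
  rintro ⟨a, rfl⟩
  exact absurd hi (by simp)

lemma posPart_single_mul_ofPowerSeries (n : ℕ) (p : PowerSeries A) :
    posPart (single ((n : ℤ) + 1) 1 * ofPowerSeries ℤ A p) =
      single ((n : ℤ) + 1) 1 * ofPowerSeries ℤ A p := by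
  ext i
  rw [coeff_posPart]
  split_ifs with hi
  · rfl
  · rw [coeff_single_mul, coeff_ofPowerSeries_of_neg _ (by omega), mul_zero]

lemma eq_single_mul_ofPowerSeries {y : HahnSeries ℤ A} {n : ℤ} (h : ∀ j < n, y.coeff j = 0) :
    y = single n 1 * ofPowerSeries ℤ A (PowerSeries.mk fun k => y.coeff (n + k)) := by
  ext i
  rw [coeff_single_mul, one_mul]
  rcases lt_or_ge i n with hi | hi
  · rw [h i hi, coeff_ofPowerSeries_of_neg _ (by omega)]
  · obtain ⟨k, hk⟩ := Int.eq_ofNat_of_zero_le (sub_nonneg.mpr hi)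
    rw [hk, ofPowerSeries_apply_coeff, PowerSeries.coeff_mk, ← hk, add_sub_cancel]

lemma ofPowerSeries_mul_single_mul (p q : PowerSeries A) (n : ℤ) (a : A) :
    ofPowerSeries ℤ A p * single n a * ofPowerSeries ℤ A q =
      single n 1 * ofPowerSeries ℤ A (p * PowerSeries.C a * q) := by
  rw [show (single n a : HahnSeries ℤ A) = single n 1 * C a by simp [C_apply, single_mul_single],
    ← mul_assoc, ← single_one_mul_comm, map_mul, map_mul, ofPowerSeries_C]
  simp only [mul_assoc]

/-- A coefficient of a Laurent series multiplied by power series on both sides. -/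
lemma coeff_ofPowerSeries_mul_mul (p q : PowerSeries A) (y : HahnSeries ℤ A) (n : ℤ) :
    (ofPowerSeries ℤ A p * y * ofPowerSeries ℤ A q).coeff n =
      ∑ᶠ k : ℕ, PowerSeries.coeff k (p * PowerSeries.C (y.coeff (n - k)) * q) := by
  obtain ⟨m, hm⟩ : ∃ m : ℤ, ∀ j < m, y.coeff j = 0 :=
    ⟨y.order, fun j hj => coeff_eq_zero_of_lt_order hj⟩
  set N : ℕ := (n - m + 1).toNat with hN
  have hN' : ∀ k : ℕ, N ≤ k → y.coeff (n - k) = 0 := fun k hk => hm _ (by omega)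
  rw [finsum_eq_sum_of_support_subset (s := Finset.range N)]
  swap
  · intro k hk
    by_contra hk'
    exact hk (by simp [hN' k (by simpa using hk')])
  set ρ := y - ∑ k ∈ Finset.range N, single (n - k : ℤ) (y.coeff (n - k)) with hρ
  have hρ0 : ∀ j < n + 1, ρ.coeff j = 0 := by
    intro j hj
    rw [hρ, coeff_sub, coeff_sum, sub_eq_zero]
    obtain ⟨k, hk⟩ := Int.eq_ofNat_of_zero_le (show 0 ≤ n - j by omega)
    obtain rfl : j = n - k := by omega
    rw [Finset.sum_eq_single k]
    · simp
    · intro b _ hb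
      exact coeff_single_of_ne (by omega)
    · intro hk'
      simp [hN' k (by simpa using hk')]
  have hy : y = ∑ k ∈ Finset.range N, single (n - k : ℤ) (y.coeff (n - k)) + ρ := by
    rw [hρ]; abel
  have hzero : (ofPowerSeries ℤ A p * ρ * ofPowerSeries ℤ A q).coeff n = 0 := by
    rw [eq_single_mul_ofPowerSeries hρ0, ← mul_assoc, ← single_one_mul_comm, mul_assoc, mul_assoc,
      ← map_mul, ← map_mul, coeff_single_mul, coeff_ofPowerSeries_of_neg _ (by omega), mul_zero]
  conv_lhs => rw [hy]
  rw [mul_add, add_mul, coeff_add, hzero, add_zero, Finset.mul_sum, Finset.sum_mul, coeff_sum]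
  refine Finset.sum_congr rfl fun k _ => ?_
  rw [ofPowerSeries_mul_single_mul, coeff_single_mul, one_mul, sub_sub_cancel,
    ofPowerSeries_apply_coeff]

lemma coeff_mul_eq_finsum (y z : HahnSeries ℤ A) (n : ℤ) :
    (y * z).coeff n = ∑ᶠ l : ℤ, y.coeff (n - l) * z.coeff l := by
  rw [coeff_mul]
  have hinj : Set.InjOn (Prod.snd : ℤ × ℤ → ℤ)
      (Finset.antidiagonal y.isPWO_support z.isPWO_support n) := by
    rintro ⟨a, b⟩ h ⟨c, d⟩ h' (rfl : b = d)
    simp only [Finset.mem_coe, Finset.mem_antidiagonal] at h h'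
    obtain rfl : a = c := by omega
    rfl
  rw [finsum_eq_sum_of_support_subset
    (s := (Finset.antidiagonal y.isPWO_support z.isPWO_support n).image Prod.snd),
    Finset.sum_image hinj]
  · refine Finset.sum_congr rfl fun ij hij => ?_
    rw [Finset.mem_antidiagonal] at hij
    rw [← hij.2.2, add_sub_cancel_right]
  · intro l hl
    simp only [Finset.coe_image, Set.mem_image, Finset.mem_coe, Finset.mem_antidiagonal]
    refine ⟨(n - l, l), ⟨?_, ?_, by omega⟩, rfl⟩
    · exact fun h => hl (by simp [h])
    · exact fun h => hl (by simp [h])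

end HahnSeries

end LaurentResidue

section LaurentCoefficients

open HahnSeries

variable {A : Type*} [Ring A]

namespace HahnSeries

lemma single_one_pow (n : ℕ) : (single 1 1 : HahnSeries ℤ A) ^ n = single (n : ℤ) 1 := by
  rw [single_pow, one_pow, nsmul_eq_mul, mul_one]

lemma mul_single_one_mul (y z : HahnSeries ℤ A) :
    y * (single 1 1 * z) = single 1 1 * (y * z) := by
  rw [← mul_assoc, ← single_one_mul_comm, mul_assoc]

/-- The residue of a product containing `k + 1` resolvents. -/
lemma coeff_one_single_pow_mul (k : ℕ) (p q : PowerSeries A) (y : HahnSeries ℤ A) :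
    (single 1 1 ^ (k + 1) * (ofPowerSeries ℤ A p * (y * ofPowerSeries ℤ A q))).coeff 1 =
      ∑ᶠ i : ℕ, PowerSeries.coeff i (p * PowerSeries.C (y.coeff (-((i : ℤ) + k))) * q) := by
  rw [single_one_pow, coeff_single_mul, one_mul, ← mul_assoc, coeff_ofPowerSeries_mul_mul]
  refine finsum_congr fun i => ?_
  rw [show (1 - ((k + 1 : ℕ) : ℤ) - i : ℤ) = -((i : ℤ) + k) by push_cast; ring]

lemma coeff_geom_mul (u : A) (q : PowerSeries A) (i : ℕ) :
    PowerSeries.coeff i (geom u * q) =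
      ∑ j ∈ Finset.range (i + 1), u ^ j * PowerSeries.coeff (i - j) q := by
  rw [PowerSeries.coeff_mul, Finset.Nat.sum_antidiagonal_eq_sum_range_succ_mk]
  simp only [PowerSeries.coeff_mk]

variable (y : HahnSeries ℤ A) (a b c u v w : A)

lemma coeff_mul_resolvent : (y * C a * resolvent v).coeff 1 =
    ∑ᶠ i : ℕ, y.coeff (-(i : ℤ)) * (a * v ^ i) := by
  have h : y * C a * resolvent v = single 1 1 ^ (0 + 1) * (ofPowerSeries ℤ A 1 *
      (y * ofPowerSeries ℤ A (PowerSeries.C a * geom v))) := by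
    simp only [resolvent, map_mul, map_one, ofPowerSeries_C, mul_assoc, mul_single_one_mul,
      zero_add, pow_one, one_mul]
  rw [h, coeff_one_single_pow_mul]
  refine finsum_congr fun i => ?_
  simp [PowerSeries.coeff_C_mul]

lemma coeff_resolvent_mul : (resolvent u * C a * y).coeff 1 =
    ∑ᶠ i : ℕ, u ^ i * (a * y.coeff (-(i : ℤ))) := by
  have h : resolvent u * C a * y = single 1 1 ^ (0 + 1) * (ofPowerSeries ℤ A
      (geom u * PowerSeries.C a) * (y * ofPowerSeries ℤ A 1)) := by
    simp only [resolvent, map_mul, map_one, ofPowerSeries_C, mul_assoc, zero_add, pow_one, mul_one]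
  rw [h, coeff_one_single_pow_mul]
  refine finsum_congr fun i => ?_
  rw [mul_one, PowerSeries.coeff_mul_C, PowerSeries.coeff_mul_C, PowerSeries.coeff_mk, mul_assoc,
    Nat.cast_zero, add_zero]

lemma coeff_resolvent_mul_mul_resolvent :
    (resolvent u * C a * y * C b * resolvent v).coeff 1 =
      ∑ᶠ i : ℕ, ∑ j ∈ Finset.range (i + 1),
        u ^ j * (a * (y.coeff (-((i : ℤ) + 1)) * (b * v ^ (i - j)))) := by
  have h : resolvent u * C a * y * C b * resolvent v = single 1 1 ^ (1 + 1) * (ofPowerSeries ℤ A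
      (geom u * PowerSeries.C a) * (y * ofPowerSeries ℤ A (PowerSeries.C b * geom v))) := by
    simp only [resolvent, map_mul, ofPowerSeries_C, mul_assoc, mul_single_one_mul _ (_ * _),
      mul_single_one_mul _ (ofPowerSeries ℤ A _), pow_succ, pow_zero, one_mul]
  rw [h, coeff_one_single_pow_mul]
  refine finsum_congr fun i => ?_
  simp only [mul_assoc, coeff_geom_mul, PowerSeries.coeff_C_mul, PowerSeries.coeff_mk,
    Nat.cast_one]

lemma coeff_mul_resolvent_mul_resolvent :
    (y * C a * resolvent w * C b * resolvent v).coeff 1 =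
      ∑ᶠ i : ℕ, ∑ j ∈ Finset.range (i + 1),
        y.coeff (-((i : ℤ) + 1)) * (a * (w ^ j * (b * v ^ (i - j)))) := by
  have h : y * C a * resolvent w * C b * resolvent v = single 1 1 ^ (1 + 1) * (ofPowerSeries ℤ A 1 *
      (y * ofPowerSeries ℤ A (PowerSeries.C a * (geom w * (PowerSeries.C b * geom v))))) := by
    simp only [resolvent, map_mul, map_one, ofPowerSeries_C, mul_assoc,
      mul_single_one_mul _ (_ * _),
      mul_single_one_mul _ (ofPowerSeries ℤ A _), pow_succ, pow_zero, one_mul]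
  rw [h, coeff_one_single_pow_mul]
  refine finsum_congr fun i => ?_
  simp only [one_mul, coeff_geom_mul, PowerSeries.coeff_C_mul, PowerSeries.coeff_mk,
    Nat.cast_one, Finset.mul_sum]

lemma coeff_resolvent_mul_resolvent_mul :
    (resolvent u * C b * resolvent w * C a * y).coeff 1 =
      ∑ᶠ i : ℕ, ∑ j ∈ Finset.range (i + 1),
        u ^ j * (b * (w ^ (i - j) * (a * y.coeff (-((i : ℤ) + 1))))) := by
  have h : resolvent u * C b * resolvent w * C a * y = single 1 1 ^ (1 + 1) * (ofPowerSeries ℤ A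
      (geom u * (PowerSeries.C b * (geom w * PowerSeries.C a))) * (y * ofPowerSeries ℤ A 1)) := by
    simp only [resolvent, map_mul, map_one, ofPowerSeries_C, mul_assoc,
      mul_single_one_mul _ (_ * _),
      mul_single_one_mul _ (ofPowerSeries ℤ A _), pow_succ, pow_zero, one_mul, mul_one]
  rw [h, coeff_one_single_pow_mul]
  refine finsum_congr fun i => ?_
  simp only [mul_assoc, mul_one, coeff_geom_mul, PowerSeries.coeff_C_mul, PowerSeries.coeff_mk,
    PowerSeries.coeff_mul_C, ← map_mul, Nat.cast_one]

lemma coeff_resolvent_mul_mul_resolvent_mul_resolvent :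
    (resolvent u * C a * y * C b * resolvent w * C c * resolvent v).coeff 1 =
      ∑ᶠ i : ℕ, ∑ j ∈ Finset.range (i + 1), ∑ l ∈ Finset.range (i - j + 1),
        u ^ j * (a * (y.coeff (-((i : ℤ) + 2)) * (b * (w ^ l * (c * v ^ (i - j - l)))))) := by
  have h : resolvent u * C a * y * C b * resolvent w * C c * resolvent v =
      single 1 1 ^ (2 + 1) * (ofPowerSeries ℤ A (geom u * PowerSeries.C a) *
      (y * ofPowerSeries ℤ A (PowerSeries.C b * (geom w * (PowerSeries.C c * geom v))))) := by
    simp only [resolvent, map_mul, ofPowerSeries_C, mul_assoc, mul_single_one_mul _ (_ * _),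
      mul_single_one_mul _ (ofPowerSeries ℤ A _), pow_succ, pow_zero, one_mul]
  rw [h, coeff_one_single_pow_mul]
  refine finsum_congr fun i => ?_
  simp only [mul_assoc, coeff_geom_mul, PowerSeries.coeff_C_mul, PowerSeries.coeff_mk,
    Nat.cast_ofNat, Finset.mul_sum]

lemma coeff_resolvent_mul_resolvent_mul_mul_resolvent :
    (resolvent u * C c * resolvent w * C a * y * C b * resolvent v).coeff 1 =
      ∑ᶠ i : ℕ, ∑ j ∈ Finset.range (i + 1), ∑ l ∈ Finset.range (i - j + 1),
        u ^ j * (c * (w ^ l * (a * (y.coeff (-((i : ℤ) + 2)) * (b * v ^ (i - j - l)))))) := by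
  have h : resolvent u * C c * resolvent w * C a * y * C b * resolvent v =
      single 1 1 ^ (2 + 1) *
      (ofPowerSeries ℤ A (geom u * (PowerSeries.C c * (geom w * PowerSeries.C a))) *
      (y * ofPowerSeries ℤ A (PowerSeries.C b * geom v))) := by
    simp only [resolvent, map_mul, ofPowerSeries_C, mul_assoc, mul_single_one_mul _ (_ * _),
      mul_single_one_mul _ (ofPowerSeries ℤ A _), pow_succ, pow_zero, one_mul]
  rw [h, coeff_one_single_pow_mul]
  refine finsum_congr fun i => ?_
  simp only [mul_assoc, coeff_geom_mul, PowerSeries.coeff_C_mul, PowerSeries.coeff_mk,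
    Nat.cast_ofNat, Finset.mul_sum]

lemma coeff_C_mul_resolvent_mul_C (i : ℕ) :
    (C a * resolvent v * C b).coeff ((i : ℤ) + 1) = a * (v ^ i * b) := by
  rw [mul_assoc, coeff_C_mul, coeff_mul_C, resolvent, coeff_single_mul, add_sub_cancel_right,
    ofPowerSeries_apply_coeff, PowerSeries.coeff_mk, one_mul]

lemma coeff_C_mul_resolvent_mul_C_mul_resolvent_mul_C (i : ℕ) :
    (C a * resolvent w * C b * resolvent v * C c).coeff ((i : ℤ) + 1) =
      ∑ j ∈ Finset.range i, a * (w ^ j * (b * (v ^ (i - 1 - j) * c))) := by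
  have h : C a * resolvent w * C b * resolvent v * C c = single 1 1 ^ 2 * ofPowerSeries ℤ A
      (PowerSeries.C a * (geom w * (PowerSeries.C b * (geom v * PowerSeries.C c)))) := by
    simp only [resolvent, map_mul, ofPowerSeries_C, mul_assoc, mul_single_one_mul _ (_ * _),
      mul_single_one_mul _ (ofPowerSeries ℤ A _), pow_succ, pow_zero, one_mul]
  rw [h, single_one_pow, coeff_single_mul, one_mul]
  cases i with
  | zero => rw [coeff_ofPowerSeries_of_neg _ (by norm_num), Finset.range_zero, Finset.sum_empty]
  | succ i =>
    rw [show (((i + 1 : ℕ) : ℤ) + 1 - ((2 : ℕ) : ℤ)) = (i : ℤ) by push_cast; ring,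
      ofPowerSeries_apply_coeff]
    simp only [coeff_geom_mul, PowerSeries.coeff_C_mul, PowerSeries.coeff_mk,
      PowerSeries.coeff_mul_C, Finset.mul_sum, Nat.add_sub_cancel]

/-- The residue-calculus complex attached to four elements of a ring satisfying the relations of
an `S`-complex with vanishing `r`. -/
noncomputable def cpx (d v δ₁ δ₂ : A) (h₁ : δ₁ * d = 0) (h₂ : d * δ₂ = 0)
    (h : d * v - v * d = δ₂ * δ₁) (hp : ∀ i : ℕ, δ₁ * (v ^ i * δ₂) = 0) :
    (residueCalculus A).Cpx where
  d := C d
  v := C v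
  δ₁ := C δ₁
  δ₂ := C δ₂
  P := resolvent v
  d_mem := C_mem_residueCalculus_const d
  v_mem := C_mem_residueCalculus_const v
  δ₁_mem := C_mem_residueCalculus_const δ₁
  δ₂_mem := C_mem_residueCalculus_const δ₂
  neg_P := posPart_single_mul_ofPowerSeries 0 _
  P_mul := resolvent_mul v
  mul_P := mul_resolvent v
  δ₁_d := by rw [← map_mul, h₁, map_zero]
  d_δ₂ := by rw [← map_mul, h₂, map_zero]
  d_v := by rw [← map_mul, ← map_mul, ← map_mul, ← map_sub, h]
  perfect := by
    have hz : PowerSeries.C δ₁ * (geom v * PowerSeries.C δ₂) = 0 := by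
      ext i
      rw [PowerSeries.coeff_C_mul, PowerSeries.coeff_mul_C, PowerSeries.coeff_mk, hp, map_zero]
    rw [resolvent, mul_single_one_mul, mul_assoc, ← ofPowerSeries_C, ← ofPowerSeries_C, ← map_mul,
      ← map_mul, mul_assoc, hz, map_zero, mul_zero]

end HahnSeries

end LaurentCoefficients

/-- A presentation of the module `X` as a direct summand of `M`. -/
class SummandOf (R M X : Type*) [Semiring R] [AddCommMonoid M] [Module R M]
    [AddCommMonoid X] [Module R X] where
  incl : X →ₗ[R] M
  proj : M →ₗ[R] X
  proj_incl : ∀ x, proj (incl x) = x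

namespace SummandOf

/-- A module is a summand of itself. -/
abbrev refl {X : Type*} [AddCommGroup X] [Module R X] : SummandOf R X X where
  incl := LinearMap.id
  proj := LinearMap.id
  proj_incl _ := rfl

/-- A summand of the first factor is a summand of the product. -/
abbrev fstOf {X M N : Type*} [AddCommGroup X] [Module R X] [AddCommGroup M]
    [Module R M] [AddCommGroup N] [Module R N] (h : SummandOf R M X) : SummandOf R (M × N) X where
  incl := LinearMap.inl R M N ∘ₗ h.incl
  proj := h.proj ∘ₗ LinearMap.fst R M N
  proj_incl := h.proj_incl

/-- A summand of the second factor is a summand of the product. -/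
abbrev sndOf {X M N : Type*} [AddCommGroup X] [Module R X] [AddCommGroup M]
    [Module R M] [AddCommGroup N] [Module R N] (h : SummandOf R N X) : SummandOf R (M × N) X where
  incl := LinearMap.inr R M N ∘ₗ h.incl
  proj := h.proj ∘ₗ LinearMap.snd R M N
  proj_incl := h.proj_incl

variable {M X Y Z : Type*} [AddCommGroup M] [Module R M] [AddCommGroup X] [Module R X]
  [AddCommGroup Y] [Module R Y] [AddCommGroup Z] [Module R Z]
  [SummandOf R M X] [SummandOf R M Y] [SummandOf R M Z]

variable (M) in
/-- Maps between summands of `M`, extended by zero to endomorphisms of `M`. -/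
def toEnd : (X →ₗ[R] Y) →+ Module.End R M where
  toFun f := incl ∘ₗ f ∘ₗ proj
  map_zero' := by ext; simp
  map_add' f g := by ext; simp

lemma toEnd_apply (f : X →ₗ[R] Y) (z : M) : 
    toEnd M f z = incl (R := R) (f (proj (R := R) z)) := rfl

lemma toEnd_injective : Function.Injective (toEnd M : (X →ₗ[R] Y) →+ Module.End R M) := by
  intro f g h
  ext x
  have hx := congrArg (fun e : Module.End R M => (proj (R := R) (e (incl (R := R) x)) : Y)) h
  simpa only [toEnd_apply, proj_incl] using hx

lemma toEnd_comp (g : Y →ₗ[R] Z) (f : X →ₗ[R] Y) :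
    toEnd M (g ∘ₗ f) = toEnd M g * toEnd M f := by
  ext z
  simp only [toEnd_apply, Module.End.mul_apply, proj_incl, LinearMap.comp_apply]

lemma toEnd_finsum {ι : Type*} (f : ι → X →ₗ[R] Y) :
    toEnd M (∑ᶠ i, f i) = ∑ᶠ i, toEnd M (f i) :=
  AddMonoidHom.map_finsum_of_injective _ toEnd_injective f

end SummandOf

section ToEndPow

open SummandOf

variable {M X Y : Type u} [AddCommGroup M] [Module R M] [AddCommGroup X] [Module R X]
  [AddCommGroup Y] [Module R Y] [SummandOf R M X] [SummandOf R M Y]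

lemma toEnd_lpow_mul_toEnd (v : X →ₗ[R] X) (i : ℕ) (f : Y →ₗ[R] X) :
    toEnd M (lpow v i) * toEnd M f = toEnd M v ^ i * toEnd M f := by
  induction i with
  | zero => rw [lpow, ← toEnd_comp, LinearMap.id_comp, pow_zero, one_mul]
  | succ i ih => rw [lpow, toEnd_comp, mul_assoc, ih, pow_succ', mul_assoc]

lemma toEnd_lpow (v : X →ₗ[R] X) (i : ℕ) :
    toEnd M (lpow v i) = toEnd M (LinearMap.id : X →ₗ[R] X) * toEnd M v ^ i := by
  induction i with
  | zero => rw [lpow, pow_zero, mul_one]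
  | succ i ih =>
    rw [lpow, toEnd_comp, ih, pow_succ', ← mul_assoc, ← mul_assoc, ← toEnd_comp, ← toEnd_comp,
      LinearMap.id_comp, LinearMap.comp_id]

lemma toEnd_mul_toEnd_lpow (v : X →ₗ[R] X) (i : ℕ) (f : X →ₗ[R] Y) :
    toEnd M f * toEnd M (lpow v i) = toEnd M f * toEnd M v ^ i := by
  rw [toEnd_lpow, ← mul_assoc, ← toEnd_comp, LinearMap.comp_id]

lemma toEnd_lpow_mul_toEnd_mul (v : X →ₗ[R] X) (i : ℕ) (f : Y →ₗ[R] X) (z : Module.End R M) :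
    toEnd M (lpow v i) * (toEnd M f * z) = toEnd M v ^ i * (toEnd M f * z) := by
  rw [← mul_assoc, toEnd_lpow_mul_toEnd, mul_assoc]

end ToEndPow

section Represent

open SummandOf HahnSeries

variable (M : Type u) [AddCommGroup M] [Module R M]

namespace SCData

variable {S : SCData R} [SummandOf R M S.Irr.carrier] [SummandOf R M S.Red.carrier]

/-- The complex attached to an `r`-perfect `S`-complex in the Laurent series over `End M`. -/
noncomputable def toCpx (hS : S.IsSComplex) (hSr : S.RPerfect) :
    (residueCalculus (Module.End R M)).Cpx :=
  cpx (toEnd M S.d) (toEnd M S.v) (toEnd M S.δ₁) (toEnd M S.δ₂)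
    (by
      have h := hS.2.2.2.2.1
      rw [hSr.2.1, LinearMap.zero_comp, add_zero] at h
      rw [← toEnd_comp, h, map_zero])
    (by
      have h := hS.2.2.2.2.2.1
      rw [hSr.2.1, LinearMap.comp_zero, sub_zero] at h
      rw [← toEnd_comp, h, map_zero])
    (by
      have h := hS.2.2.2.2.2.2.1
      rw [← toEnd_comp, ← toEnd_comp, ← toEnd_comp, ← map_sub, sub_eq_zero.mp h])
    (fun i => by
      rw [← toEnd_lpow_mul_toEnd, ← toEnd_comp, ← toEnd_comp, hSr.2.2 i, map_zero])

end SCData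

namespace HMor

variable {S T U : SCData R} [SummandOf R M S.Irr.carrier] [SummandOf R M S.Red.carrier]
  [SummandOf R M T.Irr.carrier] [SummandOf R M T.Red.carrier]
  [SummandOf R M U.Irr.carrier] [SummandOf R M U.Red.carrier]

/-- `F` assembles the components of `f`, extended to endomorphisms of `M`, into Laurent series. -/
structure Represents (f : HMor S T)
    (F : ResidueCalculus.MorData (HahnSeries ℤ (Module.End R M))) : Prop where
  lam : F.lam = C (toEnd M f.lam)
  mu : F.mu = C (toEnd M f.mu)
  del1 : F.del1 = C (toEnd M f.del1)
  del2 : F.del2 = C (toEnd M f.del2)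
  tau : ∀ i, F.tau.coeff i = toEnd M (f.tau i)

/-- The relations among the components of a height morphism. -/
structure Relations (f : HMor S T) : Prop where
  tau_eq : ∀ i : ℕ, f.tau ((i : ℤ) + 1) =
    T.δ₁ ∘ₗ lpow T.v i ∘ₗ f.del2 + f.del1 ∘ₗ lpow S.v i ∘ₗ S.δ₂ +
      ∑ j ∈ Finset.range i, T.δ₁ ∘ₗ lpow T.v j ∘ₗ f.mu ∘ₗ lpow S.v (i - 1 - j) ∘ₗ S.δ₂
  d_lam : T.d ∘ₗ f.lam - f.lam ∘ₗ S.d -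
    ∑ᶠ i : ℕ, ∑ j ∈ Finset.range (i + 1),
      lpow T.v j ∘ₗ T.δ₂ ∘ₗ f.tau (-((i : ℤ) + 1)) ∘ₗ S.δ₁ ∘ₗ lpow S.v (i - j) = 0
  δ₁_lam : -(T.δ₁ ∘ₗ f.lam) + f.del1 ∘ₗ S.d +
    ∑ᶠ i : ℕ, f.tau (-(i : ℤ)) ∘ₗ S.δ₁ ∘ₗ lpow S.v i = 0
  lam_δ₂ : f.lam ∘ₗ S.δ₂ + T.d ∘ₗ f.del2 -
    ∑ᶠ i : ℕ, lpow T.v i ∘ₗ T.δ₂ ∘ₗ f.tau (-(i : ℤ)) = 0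
  mu_d : f.mu ∘ₗ S.d + T.d ∘ₗ f.mu + f.lam ∘ₗ S.v - T.v ∘ₗ f.lam + f.del2 ∘ₗ S.δ₁ -
    T.δ₂ ∘ₗ f.del1 = 0

variable {M}

lemma Represents.compH (hS : S.IsSComplex) (hSr : S.RPerfect) (hT : T.IsSComplex)
    (hTr : T.RPerfect) (hU : U.IsSComplex) (hUr : U.RPerfect) {f : HMor S T} {g : HMor T U}
    {F G : ResidueCalculus.MorData (HahnSeries ℤ (Module.End R M))}
    (hf : f.Represents M F) (hg : g.Represents M G) :
    (g.compH f).Represents M (.comp (S.toCpx M hS hSr) (T.toCpx M hT hTr) (U.toCpx M hU hUr) G F)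
    where
  lam := by
    simp only [ResidueCalculus.MorData.comp, HMor.compH, SCData.toCpx, cpx, residueCalculus_res,
      hf.lam, hf.mu, hf.del1, hf.del2, hg.lam, hg.mu, hg.del1, hg.del2,
      coeff_resolvent_mul_mul_resolvent, coeff_resolvent_mul_mul_resolvent_mul_resolvent,
      coeff_resolvent_mul_resolvent_mul_mul_resolvent, hf.tau, hg.tau,
      ← map_mul, ← map_add]
    simp only [map_add, map_sum, toEnd_finsum, toEnd_comp,
      toEnd_lpow_mul_toEnd_mul, toEnd_mul_toEnd_lpow]
  mu := by
    simp only [ResidueCalculus.MorData.comp, HMor.compH, hf.lam, hf.mu, hf.del1, hg.lam, hg.mu,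
      hg.del2, map_add, toEnd_comp, map_mul]
  del1 := by
    simp only [ResidueCalculus.MorData.comp, HMor.compH, SCData.toCpx, cpx, residueCalculus_res,
      hf.lam, hf.mu, hf.del1, hg.del1, coeff_mul_resolvent_mul_resolvent]
    simp only [coeff_mul_resolvent, hg.tau, ← map_mul, ← map_add]
    simp only [map_add, map_sum, toEnd_finsum, toEnd_comp,
      toEnd_lpow_mul_toEnd_mul, toEnd_mul_toEnd_lpow]
  del2 := by
    simp only [ResidueCalculus.MorData.comp, HMor.compH, SCData.toCpx, cpx, residueCalculus_res,
      hf.del2, hg.lam, hg.mu, hg.del2, coeff_resolvent_mul, coeff_resolvent_mul_resolvent_mul,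
      hf.tau, ← map_mul, ← map_add]
    simp only [map_add, map_sum, toEnd_finsum, toEnd_comp,
      toEnd_lpow_mul_toEnd_mul]
  tau i := by
    simp only [ResidueCalculus.MorData.comp, HMor.compH, coeff_mul_eq_finsum, hf.tau, hg.tau,
      toEnd_finsum, toEnd_comp]

lemma Represents.isMor_iff (hS : S.IsSComplex) (hSr : S.RPerfect) (hT : T.IsSComplex)
    (hTr : T.RPerfect) {f : HMor S T}
    {F : ResidueCalculus.MorData (HahnSeries ℤ (Module.End R M))} (hf : f.Represents M F) :
    ResidueCalculus.IsMor (S.toCpx M hS hSr) (T.toCpx M hT hTr) F ↔ f.Relations := by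
  have hlam : F.lam ∈ (residueCalculus (Module.End R M)).const :=
    hf.lam ▸ C_mem_residueCalculus_const _
  have hmu : F.mu ∈ (residueCalculus (Module.End R M)).const :=
    hf.mu ▸ C_mem_residueCalculus_const _
  have hdel1 : F.del1 ∈ (residueCalculus (Module.End R M)).const :=
    hf.del1 ▸ C_mem_residueCalculus_const _
  have hdel2 : F.del2 ∈ (residueCalculus (Module.End R M)).const :=
    hf.del2 ▸ C_mem_residueCalculus_const _
  have hneg := ResidueCalculus.neg_mul_P_mul (S.toCpx M hS hSr) (T.toCpx M hT hTr) hmu hdel1 hdel2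
  have hinj {X Y : Type u} [AddCommGroup X] [Module R X] [AddCommGroup Y] [Module R Y]
      [SummandOf R M X] [SummandOf R M Y] {a b : X →ₗ[R] Y} :
      a = b ↔ toEnd M a = toEnd M b := toEnd_injective.eq_iff.symm
  suffices h : (_ ↔ _) ∧ (_ ↔ _) ∧ (_ ↔ _) ∧ (_ ↔ _) ∧ (_ ↔ _) from
    ⟨fun hF => ⟨h.1.1 hF.neg_tau, h.2.1.1 hF.d_lam, h.2.2.1.1 hF.δ₁_lam, h.2.2.2.1.1 hF.lam_δ₂,
        h.2.2.2.2.1 hF.mu_d⟩,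
      fun hf => ⟨hlam, hmu, hdel1, hdel2, h.1.2 hf.tau_eq, h.2.1.2 hf.d_lam, h.2.2.1.2 hf.δ₁_lam,
        h.2.2.2.1.2 hf.lam_δ₂, h.2.2.2.2.2 hf.mu_d⟩⟩
  refine ⟨(posPart_eq_iff hneg).trans (forall_congr' fun i => ?_), ?_, ?_, ?_, ?_⟩
  · refine Iff.trans ?_ hinj.symm
    simp only [SCData.toCpx, cpx, hf.mu, hf.del1, hf.del2, hf.tau, coeff_add,
      coeff_C_mul_resolvent_mul_C_mul_resolvent_mul_C, coeff_C_mul_resolvent_mul_C,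
      map_add, map_sum, toEnd_comp, toEnd_lpow_mul_toEnd, toEnd_lpow_mul_toEnd_mul]
  · rw [sub_eq_zero, hinj]
    simp only [SCData.toCpx, cpx, residueCalculus_res, hf.lam, coeff_resolvent_mul_mul_resolvent,
      hf.tau, ← map_mul, ← map_sub, C_injective.eq_iff]
    simp only [map_sub, map_sum, toEnd_finsum, toEnd_comp,
      toEnd_lpow_mul_toEnd_mul, toEnd_mul_toEnd_lpow]
  · rw [neg_add_eq_sub, ← neg_sub (T.δ₁ ∘ₗ f.lam), neg_add_eq_zero, hinj]
    simp only [SCData.toCpx, cpx, residueCalculus_res, hf.lam, hf.del1, coeff_mul_resolvent,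
      hf.tau, ← map_mul, ← map_sub, C_injective.eq_iff]
    simp only [map_sub, toEnd_finsum, toEnd_comp, toEnd_mul_toEnd_lpow]
  · rw [sub_eq_zero, hinj]
    simp only [SCData.toCpx, cpx, residueCalculus_res, hf.lam, hf.del2, coeff_resolvent_mul,
      hf.tau, ← map_mul, ← map_add, C_injective.eq_iff]
    simp only [map_add, toEnd_finsum, toEnd_comp, toEnd_lpow_mul_toEnd_mul]
  · rw [hinj]
    simp only [SCData.toCpx, cpx, hf.lam, hf.mu, hf.del1, hf.del2, ← map_mul, ← map_add, ← map_sub,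
      map_eq_zero_iff C C_injective]
    simp only [map_add, map_sub, map_zero, toEnd_comp]

/-- A height morphism whose maps `τ_i` vanish for `i ≪ 0` is represented by Laurent series. -/
lemma exists_represents {f : HMor S T} {n : ℤ} (h : ∀ i < n, f.tau i = 0) :
    ∃ F, f.Represents M F :=
  ⟨{ lam := C (toEnd M f.lam)
     mu := C (toEnd M f.mu)
     del1 := C (toEnd M f.del1)
     del2 := C (toEnd M f.del2)
     tau := ofSuppBddBelow (fun i => toEnd M (f.tau i))
      ⟨n, fun i hi => not_lt.mp fun hlt => hi (by simp only [h i hlt, map_zero])⟩ },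
    rfl, rfl, rfl, rfl, fun _ => rfl⟩

end HMor

end Represent

namespace GradedMod.IsDeg

variable {M N P : GradedMod R} {k l : ℤ}

lemma of_eq {f : M.carrier →ₗ[R] N.carrier} (hf : M.IsDeg N k f) (h : k = l) : M.IsDeg N l f :=
  h ▸ hf

lemma zero : M.IsDeg N k 0 := fun _ => by
  rw [Submodule.map_zero]
  exact bot_le

lemma add {f g : M.carrier →ₗ[R] N.carrier} (hf : M.IsDeg N k f) (hg : M.IsDeg N k g) :
    M.IsDeg N k (f + g) := fun i => by
  rintro _ ⟨z, hz, rfl⟩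
  exact Submodule.add_mem _ (hf i ⟨z, hz, rfl⟩) (hg i ⟨z, hz, rfl⟩)

lemma sum {ι : Type*} {s : Finset ι} {f : ι → M.carrier →ₗ[R] N.carrier}
    (hf : ∀ i ∈ s, M.IsDeg N k (f i)) : M.IsDeg N k (∑ i ∈ s, f i) :=
  Finset.sum_induction _ _ (fun _ _ => add) zero hf

lemma finsum {ι : Type*} {f : ι → M.carrier →ₗ[R] N.carrier} (hf : ∀ i, M.IsDeg N k (f i)) :
    M.IsDeg N k (∑ᶠ i, f i) :=
  finsum_induction _ zero (fun _ _ => add) hf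

lemma comp {g : N.carrier →ₗ[R] P.carrier} {f : M.carrier →ₗ[R] N.carrier} (hg : N.IsDeg P l g)
    (hf : M.IsDeg N k f) : M.IsDeg P (k + l) (g ∘ₗ f) := fun i => by
  rintro _ ⟨z, hz, rfl⟩
  rw [← add_assoc]
  exact hg (i + k) ⟨f z, hf i ⟨z, hz, rfl⟩, rfl⟩

lemma lpow {f : M.carrier →ₗ[R] M.carrier} (hf : M.IsDeg M k f) :
    ∀ i : ℕ, M.IsDeg M (i * k) (lpow f i)
  | 0 => fun i => by
    rintro _ ⟨z, hz, rfl⟩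
    simpa [_root_.lpow] using hz
  | i + 1 => (hf.comp (hf.lpow i)).of_eq (by push_cast; ring)

end GradedMod.IsDeg

namespace HMor

variable {S T U : SCData R}

/-- The components of `f` have the degrees of a height morphism of degree `k`. -/
structure Degrees (f : HMor S T) (k : ℤ) : Prop where
  lam : S.Irr.IsDeg T.Irr k f.lam
  mu : S.Irr.IsDeg T.Irr (k - 1) f.mu
  del1 : S.Irr.IsDeg T.Red k f.del1
  del2 : S.Red.IsDeg T.Irr (k - 1) f.del2
  tau : ∀ i : ℤ, S.Red.IsDeg T.Red (k - 2 * i) (f.tau i)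

lemma Degrees.compH {f : HMor S T} {g : HMor T U} {k k' : ℤ} (hS : S.Degrees) (hT : T.Degrees)
    (hU : U.Degrees) (hf : f.Degrees k) (hg : g.Degrees k') :
    (g.compH f).Degrees (k + k') := by
  obtain ⟨-, hSv, hSδ₁, -, -⟩ := hS
  obtain ⟨-, hTv, hTδ₁, hTδ₂, -⟩ := hT
  obtain ⟨-, hUv, -, hUδ₂, -⟩ := hU
  refine ⟨?_, ?_, ?_, ?_, fun i => ?_⟩
  · refine ((((hg.lam.comp hf.lam).add (.finsum fun i => .sum fun j hj => ?_)).add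
      (.finsum fun i => .sum fun j hj => ?_)).add
      (.finsum fun i => .sum fun j hj => .sum fun l hl => ?_)).add
      (.finsum fun i => .sum fun j hj => .sum fun l hl => ?_)
    all_goals rw [Finset.mem_range] at hj
    · exact ((hUv.lpow j).comp (hUδ₂.comp ((hg.tau _).comp (hf.del1.comp
        (hSv.lpow (i - j)))))).of_eq (by omega)
    · exact ((hUv.lpow j).comp (hg.del2.comp ((hf.tau _).comp (hSδ₁.comp
        (hSv.lpow (i - j)))))).of_eq (by omega)
    · rw [Finset.mem_range] at hl
      exact ((hUv.lpow j).comp (hUδ₂.comp ((hg.tau _).comp (hTδ₁.comp ((hTv.lpow l).comp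
        (hf.mu.comp (hSv.lpow (i - j - l)))))))).of_eq (by omega)
    · rw [Finset.mem_range] at hl
      exact ((hUv.lpow j).comp (hg.mu.comp ((hTv.lpow l).comp (hTδ₂.comp ((hf.tau _).comp
        (hSδ₁.comp (hSv.lpow (i - j - l)))))))).of_eq (by omega)
  · exact (((hg.lam.comp hf.mu).of_eq (by ring)).add ((hg.mu.comp hf.lam).of_eq (by ring))).add
      ((hg.del2.comp hf.del1).of_eq (by ring))
  · refine ((hg.del1.comp hf.lam).add (.finsum fun i => ?_)).add
      (.finsum fun i => .sum fun j hj => ?_)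
    · exact ((hg.tau _).comp (hf.del1.comp (hSv.lpow i))).of_eq (by ring)
    · rw [Finset.mem_range] at hj
      exact ((hg.tau _).comp (hTδ₁.comp ((hTv.lpow j).comp (hf.mu.comp
        (hSv.lpow (i - j)))))).of_eq (by omega)
  · refine (((hg.lam.comp hf.del2).of_eq (by ring)).add (.finsum fun i => ?_)).add
      (.finsum fun i => .sum fun j hj => ?_)
    · exact ((hUv.lpow i).comp (hg.del2.comp (hf.tau _))).of_eq (by ring)
    · rw [Finset.mem_range] at hj
      exact ((hUv.lpow j).comp (hg.mu.comp ((hTv.lpow (i - j)).comp (hTδ₂.comp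
        (hf.tau _))))).of_eq (by omega)
  · exact .finsum fun l => ((hg.tau (i - l)).comp (hf.tau l)).of_eq (by ring)

lemma compH_tau_eq_zero {f : HMor S T} {g : HMor T U} {n m : ℤ} (hf : ∀ i < n, f.tau i = 0)
    (hg : ∀ i < m, g.tau i = 0) {i : ℤ} (hi : i < n + m) : (g.compH f).tau i = 0 := by
  refine finsum_eq_zero_of_forall_eq_zero fun l => ?_
  rcases lt_or_ge l n with hl | hl
  · rw [hf l hl, LinearMap.comp_zero]
  · rw [hg (i - l) (by omega), LinearMap.zero_comp]

lemma compH_tau_add {f : HMor S T} {g : HMor T U} {n m : ℤ} (hf : ∀ i < n, f.tau i = 0)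
    (hg : ∀ i < m, g.tau i = 0) : (g.compH f).tau (n + m) = g.tau m ∘ₗ f.tau n := by
  refine (finsum_eq_single _ n fun l hl => ?_).trans (by rw [add_sub_cancel_left])
  rcases lt_or_gt_of_ne hl with hl | hl
  · rw [hf l hl, LinearMap.comp_zero]
  · rw [hg (n + m - l) (by omega), LinearMap.zero_comp]

lemma Relations.compH (hS : S.IsSComplex) (hSr : S.RPerfect) (hT : T.IsSComplex)
    (hTr : T.RPerfect) (hU : U.IsSComplex) (hUr : U.RPerfect) {f : HMor S T} {g : HMor T U}
    {n m : ℤ} (hfn : ∀ i < n, f.tau i = 0) (hgm : ∀ i < m, g.tau i = 0)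
    (hf : f.Relations) (hg : g.Relations) : (g.compH f).Relations := by
  let M := (S.Irr.carrier × S.Red.carrier) × (T.Irr.carrier × T.Red.carrier) ×
    (U.Irr.carrier × U.Red.carrier)
  let _ : SummandOf R M S.Irr.carrier := .fstOf (.fstOf .refl)
  let _ : SummandOf R M S.Red.carrier := .fstOf (.sndOf .refl)
  let _ : SummandOf R M T.Irr.carrier := .sndOf (.fstOf (.fstOf .refl))
  let _ : SummandOf R M T.Red.carrier := .sndOf (.fstOf (.sndOf .refl))
  let _ : SummandOf R M U.Irr.carrier := .sndOf (.sndOf (.fstOf .refl))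
  let _ : SummandOf R M U.Red.carrier := .sndOf (.sndOf (.sndOf .refl))
  obtain ⟨F, hF⟩ := exists_represents (M := M) hfn
  obtain ⟨G, hG⟩ := exists_represents (M := M) hgm
  exact ((hF.compH hS hSr hT hTr hU hUr hG).isMor_iff hS hSr hU hUr).mp
    (((hF.isMor_iff hS hSr hT hTr).mpr hf).comp ((hG.isMor_iff hT hTr hU hUr).mpr hg))

end HMor

/-- The composition of a (strong) height `n` morphism and a (strong)
height `m` morphism between `r`-perfect `S`-complexes, `n, m ∈ ℤ`, defined by the explicit
composition formulas, is a (strong) height `n + m` morphism. -/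
theorem compH_isHeightMor {R : Type u} [CommRing R] {S T U : SCData R}
    (hS : S.IsSComplex) (hSr : S.RPerfect) (hT : T.IsSComplex) (hTr : T.RPerfect)
    (hU : U.IsSComplex) (hUr : U.RPerfect)
    (f : HMor S T) (g : HMor T U) (n m k k' : ℤ)
    (hf : f.IsHeightMor n k) (hg : g.IsHeightMor m k') :
    (g.compH f).IsHeightMor (n + m) (k + k') ∧
    (Function.Bijective ⇑(f.tau n) → Function.Bijective ⇑(g.tau m) →
      Function.Bijective ⇑((g.compH f).tau (n + m))) := by
  obtain ⟨hk, hf₁, hf₂, hf₃, hf₄, hf₅, hfn, hfr⟩ := hf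
  obtain ⟨hk', hg₁, hg₂, hg₃, hg₄, hg₅, hgm, hgr⟩ := hg
  refine ⟨?_, fun hfb hgb => ?_⟩
  · have hd := HMor.Degrees.compH hS.2.2.1 hT.2.2.1 hU.2.2.1 ⟨hf₁, hf₂, hf₃, hf₄, hf₅⟩
      ⟨hg₁, hg₂, hg₃, hg₄, hg₅⟩
    have hr := HMor.Relations.compH hS hSr hT hTr hU hUr hfn hgm
      ⟨hfr.1, hfr.2.1, hfr.2.2.1, hfr.2.2.2.1, hfr.2.2.2.2⟩
      ⟨hgr.1, hgr.2.1, hgr.2.2.1, hgr.2.2.2.1, hgr.2.2.2.2⟩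
    exact ⟨hk.add hk', hd.lam, hd.mu, hd.del1, hd.del2, hd.tau,
      fun _ hi => HMor.compH_tau_eq_zero hfn hgm hi, hr.tau_eq, hr.d_lam, hr.δ₁_lam, hr.lam_δ₂,
      hr.mu_d⟩
  · rw [HMor.compH_tau_add hfn hgm]
    exact hgb.comp hfb
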